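/- arXiv:1509.02469 — 3 statements merged into one kernel-verified Lean document; each statement's English description precedes it below -/
import Mathlib

section
/- Consider the Onsager free energy F(·,λ) with the Onsager kernel K_O(p,q) = √(1 − (p·q)²) and let ρ₀ ≡ 1/(4π). If λ > π/32, then ρ₀ is a local minimiser of F(·,λ) among probability densities in the L^∞ topology: there is ε > 0 such that F(ρ,λ) ≥ F(ρ₀,λ) for every probability density ρ with ‖ρ − ρ₀‖_{L^∞(S²)} < ε. If 0 < λ < π/32, then ρ₀ is not a local minimiser: for every ε > 0 there is a probability density ρ with ‖ρ − ρ₀‖_{L^∞(S²)} < ε and F(ρ,λ) < F(ρ₀,λ). -/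
open MeasureTheory

noncomputable section

/-- The unit sphere `S²` in `ℝ³`. -/
abbrev S2 := Metric.sphere (0 : EuclideanSpace ℝ (Fin 3)) 1

/-- The surface measure on `S²` (of total mass `4π`). -/
def sphereMeasure : Measure S2 := (volume : Measure (EuclideanSpace ℝ (Fin 3))).toSphere

/-- A probability density on `S²`: a nonnegative measurable function integrating to `1`. -/
def IsProbDensity (ρ : S2 → ℝ) : Prop :=
  Measurable ρ ∧ (∀ p, 0 ≤ ρ p) ∧ (∫ p, ρ p ∂sphereMeasure) = 1

/-- The Onsager free energy with interaction kernel `K` and parameter `λ`: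
`F(ρ,λ) = λ ∫ ρ ln ρ + (1/2) ∫∫ K(p,q) ρ(p) ρ(q)`. -/
def onsagerF (K : S2 → S2 → ℝ) (lam : ℝ) (ρ : S2 → ℝ) : ℝ :=
  lam * ∫ p, ρ p * Real.log (ρ p) ∂sphereMeasure +
    (1 / 2) * ∫ p, (∫ q, K p q * ρ p * ρ q ∂sphereMeasure) ∂sphereMeasure

/-- The Onsager kernel `K_O(p,q) = √(1 − (p·q)²)`. -/
def onsagerKernel (p q : S2) : ℝ :=
  Real.sqrt (1 - (inner (𝕜 := ℝ) (p : EuclideanSpace ℝ (Fin 3))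
    (q : EuclideanSpace ℝ (Fin 3))) ^ 2)

theorem integral_radial_mul_sphere (w : ℝ → ℝ) (g : EuclideanSpace ℝ (Fin 3) → ℝ) :
    ∫ x : EuclideanSpace ℝ (Fin 3), w ‖x‖ * g (‖x‖⁻¹ • x) =
      (∫ r in Set.Ioi (0 : ℝ), r ^ 2 * w r) *
        ∫ p, g (p : EuclideanSpace ℝ (Fin 3)) ∂sphereMeasure := by
  set μ : Measure (EuclideanSpace ℝ (Fin 3)) := volume
  calc
    ∫ x, w ‖x‖ * g (‖x‖⁻¹ • x) ∂μ
      = ∫ x : ({(0)}ᶜ : Set (EuclideanSpace ℝ (Fin 3))),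
          w ‖x.1‖ * g (‖x.1‖⁻¹ • x.1) ∂(μ.comap (↑)) := by
      rw [integral_subtype_comap (measurableSet_singleton _).compl
        fun x ↦ w ‖x‖ * g (‖x‖⁻¹ • x), restrict_compl_singleton]
    _ = ∫ x : S2 × Set.Ioi (0 : ℝ), g x.1 * w x.2
          ∂μ.toSphere.prod (.volumeIoiPow (Module.finrank ℝ (EuclideanSpace ℝ (Fin 3)) - 1)) := by
      have := μ.measurePreserving_homeomorphUnitSphereProd.integral_comp
        (Homeomorph.measurableEmbedding _)
        (fun x : S2 × Set.Ioi (0 : ℝ) ↦ g x.1 * w x.2)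
      rw [← this]
      refine integral_congr_ae (.of_forall fun x ↦ ?_)
      simp [mul_comm]
    _ = (∫ p, g p ∂μ.toSphere) * ∫ r : Set.Ioi (0 : ℝ), w r
          ∂.volumeIoiPow (Module.finrank ℝ (EuclideanSpace ℝ (Fin 3)) - 1) :=
      integral_prod_mul (fun p : S2 ↦ g p) (fun r : Set.Ioi (0 : ℝ) ↦ w r)
    _ = _ := by
      rw [mul_comm]
      congr 1
      simp only [Measure.volumeIoiPow, ENNReal.ofReal]
      rw [integral_withDensity_eq_integral_smul
          ((measurable_subtype_coe.pow_const _).real_toNNReal),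
        integral_subtype_comap measurableSet_Ioi fun a ↦ Real.toNNReal
          (a ^ (Module.finrank ℝ (EuclideanSpace ℝ (Fin 3)) - 1)) • w a]
      refine setIntegral_congr_fun measurableSet_Ioi fun x hx ↦ ?_
      simp [NNReal.smul_def, Real.coe_toNNReal _ (pow_nonneg (Set.mem_Ioi.1 hx).le _)]

/-- The half-line Gaussian moment `∫₀^∞ rⁿ e^{-r²} dr`. -/
def gaussMoment (n : ℕ) : ℝ := ∫ r in Set.Ioi (0 : ℝ), r ^ n * Real.exp (-r ^ 2)

theorem gaussMoment_eq_Gamma (n : ℕ) : gaussMoment n = 1 / 2 * Real.Gamma ((n + 1) / 2) := by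
  have h := integral_rpow_mul_exp_neg_rpow (p := 2) (q := n) (by norm_num)
    (by linarith [(Nat.cast_nonneg n : (0 : ℝ) ≤ n)])
  rw [← h]
  simp only [gaussMoment]
  refine setIntegral_congr_fun measurableSet_Ioi fun x _ ↦ ?_
  norm_num

theorem gaussMoment_add_two (n : ℕ) : gaussMoment (n + 2) = (n + 1) / 2 * gaussMoment n := by
  rw [gaussMoment_eq_Gamma, gaussMoment_eq_Gamma]
  have h : (((n + 2 : ℕ) : ℝ) + 1) / 2 = (n + 1) / 2 + 1 := by push_cast; ring
  rw [h, Real.Gamma_add_one (by positivity)]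
  ring

theorem gaussMoment_zero : gaussMoment 0 = √Real.pi / 2 := by
  rw [gaussMoment_eq_Gamma]
  have := Real.Gamma_one_half_eq
  norm_num at this ⊢
  rw [this]; ring

theorem gaussMoment_one : gaussMoment 1 = 1 / 2 := by
  rw [gaussMoment_eq_Gamma]; norm_num

theorem integral_abs_pow_mul_exp (a : ℕ) :
    ∫ x : ℝ, |x| ^ a * Real.exp (-x ^ 2) = 2 * gaussMoment a := by
  rw [gaussMoment, ← integral_comp_abs (f := fun x ↦ x ^ a * Real.exp (-x ^ 2))]
  simp

theorem integral_sqrt_pow_mul_exp (b : ℕ) :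
    ∫ x : ℝ × ℝ, √(x.1 ^ 2 + x.2 ^ 2) ^ b * Real.exp (-(x.1 ^ 2 + x.2 ^ 2)) =
      2 * Real.pi * gaussMoment (b + 1) := by
  rw [← integral_comp_polarCoord_symm, polarCoord_target]
  have h : ∀ x ∈ Set.Ioi (0 : ℝ) ×ˢ Set.Ioo (-Real.pi) Real.pi,
      x.1 • (√((polarCoord.symm x).1 ^ 2 + (polarCoord.symm x).2 ^ 2) ^ b *
        Real.exp (-((polarCoord.symm x).1 ^ 2 + (polarCoord.symm x).2 ^ 2))) =
      (x.1 ^ (b + 1) * Real.exp (-x.1 ^ 2)) * 1 := by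
    rintro ⟨r, t⟩ ⟨hr, -⟩
    have h1 : (r * Real.cos t) ^ 2 + (r * Real.sin t) ^ 2 = r ^ 2 := by
      linear_combination r ^ 2 * Real.sin_sq_add_cos_sq t
    simp only [polarCoord_symm_apply, h1, smul_eq_mul]
    rw [Real.sqrt_sq (Set.mem_Ioi.1 hr).le]
    ring
  rw [setIntegral_congr_fun (measurableSet_Ioi.prod measurableSet_Ioo) h, Measure.volume_eq_prod,
    setIntegral_prod_mul (fun r : ℝ ↦ r ^ (b + 1) * Real.exp (-r ^ 2)) (fun _ : ℝ ↦ (1 : ℝ))]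
  have : ∫ _ in Set.Ioo (-Real.pi) Real.pi, (1 : ℝ) = 2 * Real.pi := by
    simp [Real.pi_pos.le, two_mul]
  rw [this, gaussMoment]
  ring

theorem integral_euclidean_fin_three (f : ℝ → ℝ × ℝ → ℝ) :
    ∫ x : EuclideanSpace ℝ (Fin 3), f (x 2) (x 0, x 1) = ∫ y : ℝ × (ℝ × ℝ), f y.1 y.2 := by
  rw [← (PiLp.volume_preserving_toLp (Fin 3)).integral_comp
    (MeasurableEquiv.toLp 2 (Fin 3 → ℝ)).measurableEmbedding]
  have h1 := (volume_preserving_piFinSuccAbove (fun _ : Fin 3 ↦ ℝ) 2).integral_comp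
    (MeasurableEquiv.measurableEmbedding _) (fun y ↦ f y.1 (y.2 0, y.2 1))
  have h2 := ((MeasurePreserving.id (volume : Measure ℝ)).prod
    (volume_preserving_finTwoArrow ℝ)).integral_comp
    ((MeasurableEquiv.refl ℝ).prodCongr
      (MeasurableEquiv.finTwoArrow (α := ℝ))).measurableEmbedding (fun y ↦ f y.1 y.2)
  exact h1.trans h2

theorem integral_sphere_abs_pow_mul_sqrt_pow (a b : ℕ) :
    gaussMoment (a + b + 2) * ∫ p : S2, |p.1 2| ^ a * √(p.1 0 ^ 2 + p.1 1 ^ 2) ^ b ∂sphereMeasure =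
      4 * Real.pi * gaussMoment a * gaussMoment (b + 1) := by
  have h := integral_radial_mul_sphere (fun r ↦ r ^ (a + b) * Real.exp (-r ^ 2))
    (fun x ↦ |x 2| ^ a * √(x 0 ^ 2 + x 1 ^ 2) ^ b)
  have h3 : gaussMoment (a + b + 2) =
      ∫ r in Set.Ioi (0 : ℝ), r ^ 2 * (r ^ (a + b) * Real.exp (-r ^ 2)) := by
    simp only [gaussMoment]
    congr 1; ext r; ring
  rw [h3, ← h]
  have h4 : ∀ᵐ x : EuclideanSpace ℝ (Fin 3), ‖x‖ ^ (a + b) * Real.exp (-‖x‖ ^ 2) *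
      (|(‖x‖⁻¹ • x) 2| ^ a * √((‖x‖⁻¹ • x) 0 ^ 2 + (‖x‖⁻¹ • x) 1 ^ 2) ^ b) =
      (|x 2| ^ a * Real.exp (-x 2 ^ 2)) *
        (√(x 0 ^ 2 + x 1 ^ 2) ^ b * Real.exp (-(x 0 ^ 2 + x 1 ^ 2))) := by
    have h0 : ∀ᵐ x : EuclideanSpace ℝ (Fin 3), x ≠ 0 := by
      simp [ae_iff]
    filter_upwards [h0] with x hx
    have hn : 0 < ‖x‖ := norm_pos_iff.2 hx
    have e1 : ‖x‖ ^ 2 = x 2 ^ 2 + (x 0 ^ 2 + x 1 ^ 2) := by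
      rw [EuclideanSpace.norm_sq_eq, Fin.sum_univ_three]
      simp only [Real.norm_eq_abs, sq_abs]; ring
    have e2 : √((‖x‖⁻¹ • x) 0 ^ 2 + (‖x‖⁻¹ • x) 1 ^ 2) = ‖x‖⁻¹ * √(x 0 ^ 2 + x 1 ^ 2) := by
      simp only [PiLp.smul_apply, smul_eq_mul, mul_pow, ← mul_add]
      rw [Real.sqrt_mul (by positivity), Real.sqrt_sq (by positivity)]
    have e3 : |(‖x‖⁻¹ • x) 2| = ‖x‖⁻¹ * |x 2| := by
      simp [abs_mul]
    rw [e2, e3, mul_pow, mul_pow, e1, neg_add, Real.exp_add, pow_add]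
    have : ‖x‖ ^ a * (‖x‖⁻¹) ^ a = 1 := by rw [← mul_pow, mul_inv_cancel₀ hn.ne', one_pow]
    have h' : ‖x‖ ^ b * (‖x‖⁻¹) ^ b = 1 := by rw [← mul_pow, mul_inv_cancel₀ hn.ne', one_pow]
    generalize ‖x‖ = n at *
    generalize n⁻¹ = m at *
    linear_combination (Real.exp (-x.ofLp 2 ^ 2) * Real.exp (-(x.ofLp 0 ^ 2 + x.ofLp 1 ^ 2)) *
      |x.ofLp 2| ^ a * √(x.ofLp 0 ^ 2 + x.ofLp 1 ^ 2) ^ b) * (n ^ b * m ^ b * this + h')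
  rw [integral_congr_ae h4, integral_euclidean_fin_three
    (fun z y ↦ (|z| ^ a * Real.exp (-z ^ 2)) *
        (√(y.1 ^ 2 + y.2 ^ 2) ^ b * Real.exp (-(y.1 ^ 2 + y.2 ^ 2)))), Measure.volume_eq_prod,
    integral_prod_mul (fun z : ℝ ↦ |z| ^ a * Real.exp (-z ^ 2)) (fun y : ℝ × ℝ ↦
        √(y.1 ^ 2 + y.2 ^ 2) ^ b * Real.exp (-(y.1 ^ 2 + y.2 ^ 2))),
    integral_abs_pow_mul_exp, integral_sqrt_pow_mul_exp]
  ring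

theorem sphere_sq_add_sq (p : S2) : p.1 0 ^ 2 + p.1 1 ^ 2 = 1 - p.1 2 ^ 2 := by
  have h : ‖p.1‖ ^ 2 = 1 := by simp
  rw [EuclideanSpace.norm_sq_eq, Fin.sum_univ_three] at h
  simp only [Real.norm_eq_abs, sq_abs] at h
  linarith

theorem integral_sphere_one : ∫ _ : S2, (1 : ℝ) ∂sphereMeasure = 4 * Real.pi := by
  have h := integral_sphere_abs_pow_mul_sqrt_pow 0 0
  simp only [gaussMoment_add_two, gaussMoment_zero, gaussMoment_one, zero_add, pow_zero,
    mul_one] at h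
  have hp : 0 < √Real.pi := by positivity
  apply mul_left_cancel₀ hp.ne'
  push_cast at h
  linarith

theorem integral_sphere_sq : ∫ p : S2, p.1 2 ^ 2 ∂sphereMeasure = 4 * Real.pi / 3 := by
  have h := integral_sphere_abs_pow_mul_sqrt_pow 2 0
  simp only [gaussMoment_add_two, gaussMoment_zero, gaussMoment_one, zero_add, pow_zero,
    mul_one, add_zero, sq_abs] at h
  have hp : 0 < √Real.pi := by positivity
  apply mul_left_cancel₀ hp.ne'
  push_cast at h
  linarith

theorem integral_sphere_pow_four : ∫ p : S2, p.1 2 ^ 4 ∂sphereMeasure = 4 * Real.pi / 5 := by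
  have h := integral_sphere_abs_pow_mul_sqrt_pow 4 0
  have e : ∀ x : ℝ, |x| ^ 4 = x ^ 4 := fun x ↦ by rw [show 4 = 2 * 2 by rfl, pow_mul, sq_abs, pow_mul]
  simp only [gaussMoment_add_two, gaussMoment_zero, gaussMoment_one, zero_add, pow_zero,
    mul_one, add_zero, e] at h
  have hp : 0 < √Real.pi := by positivity
  apply mul_left_cancel₀ hp.ne'
  push_cast at h
  linarith

theorem integral_sphere_sqrt : ∫ p : S2, √(1 - p.1 2 ^ 2) ∂sphereMeasure = Real.pi ^ 2 := by
  have h := integral_sphere_abs_pow_mul_sqrt_pow 0 1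
  have e2 : gaussMoment 2 = 1 / 2 * gaussMoment 0 := by simpa using gaussMoment_add_two 0
  simp only [gaussMoment_add_two, e2, gaussMoment_zero, gaussMoment_one, zero_add, pow_zero,
    one_add_one_eq_two, pow_one, one_mul, sphere_sq_add_sq] at h
  have hp : √Real.pi * √Real.pi = Real.pi := Real.mul_self_sqrt Real.pi_pos.le
  push_cast at h
  linear_combination 2 * h + Real.pi * hp

theorem integral_sphere_sq_mul_sqrt :
    ∫ p : S2, p.1 2 ^ 2 * √(1 - p.1 2 ^ 2) ∂sphereMeasure = Real.pi ^ 2 / 4 := by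
  have h := integral_sphere_abs_pow_mul_sqrt_pow 2 1
  have e2 : gaussMoment 2 = 1 / 2 * gaussMoment 0 := by simpa using gaussMoment_add_two 0
  simp only [gaussMoment_add_two, e2, gaussMoment_zero, gaussMoment_one,
    one_add_one_eq_two, Nat.reduceAdd, pow_one, sphere_sq_add_sq, sq_abs] at h
  have hp : √Real.pi * √Real.pi = Real.pi := Real.mul_self_sqrt Real.pi_pos.le
  push_cast at h
  linear_combination h + Real.pi / 4 * hp

instance : IsFiniteMeasure sphereMeasure := by
  unfold sphereMeasure; infer_instance

theorem integral_sphere_comp_isometry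
    (L : EuclideanSpace ℝ (Fin 3) ≃ₗᵢ[ℝ] EuclideanSpace ℝ (Fin 3))
    (g : EuclideanSpace ℝ (Fin 3) → ℝ) :
    ∫ p : S2, g (L p) ∂sphereMeasure = ∫ p : S2, g p ∂sphereMeasure := by
  have h1 := integral_radial_mul_sphere (fun r ↦ Real.exp (-r ^ 2)) (fun x ↦ g (L x))
  have h2 := integral_radial_mul_sphere (fun r ↦ Real.exp (-r ^ 2)) g
  have h3 := L.measurePreserving.integral_comp L.toHomeomorph.measurableEmbedding
    (fun x ↦ Real.exp (-‖x‖ ^ 2) * g (‖x‖⁻¹ • x))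
  simp only [LinearIsometryEquiv.norm_map, map_smul] at h1 h3
  rw [h1, h2] at h3
  have h0 : gaussMoment 2 ≠ 0 := by
    rw [show gaussMoment 2 = _ from gaussMoment_add_two 0, gaussMoment_zero]
    positivity
  exact mul_left_cancel₀ h0 h3

theorem integrable_sphere_of_continuous {g : S2 → ℝ} (hg : Continuous g) :
    Integrable g sphereMeasure :=
  hg.integrable_of_hasCompactSupport (HasCompactSupport.of_compactSpace _)

theorem exists_isometry_apply_eq_pole (q : S2) :
    ∃ L : EuclideanSpace ℝ (Fin 3) ≃ₗᵢ[ℝ] EuclideanSpace ℝ (Fin 3),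
      L q = EuclideanSpace.single 2 1 := by
  refine ⟨(ℝ ∙ (q.1 - EuclideanSpace.single 2 1))ᗮ.reflection, ?_⟩
  exact Submodule.reflection_sub (by simp)

/-- The inner product of two points of the sphere. -/
def sphereInner (p q : S2) : ℝ :=
  inner (𝕜 := ℝ) (p : EuclideanSpace ℝ (Fin 3)) (q : EuclideanSpace ℝ (Fin 3))

theorem integral_zonal (f : ℝ → ℝ) (q : S2) :
    ∫ p, f (sphereInner p q) ∂sphereMeasure = ∫ p : S2, f (p.1 2) ∂sphereMeasure := by
  obtain ⟨L, hL⟩ := exists_isometry_apply_eq_pole q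
  rw [← integral_sphere_comp_isometry L (fun x ↦ f (x 2))]
  congr 1; ext p
  rw [sphereInner, ← L.inner_map_map, hL]
  simp [EuclideanSpace.inner_single_right]

/-- The linear isometry multiplying each coordinate by a sign. -/
def signFlip (s : Fin 3 → ℝ ≃ₗᵢ[ℝ] ℝ) :
    EuclideanSpace ℝ (Fin 3) ≃ₗᵢ[ℝ] EuclideanSpace ℝ (Fin 3) :=
  LinearIsometryEquiv.piLpCongrRight 2 s

theorem integral_zonal_mul_coord_zero_mul_coord_one (f : ℝ → ℝ) :
    ∫ p : S2, f (p.1 2) * (p.1 0 * p.1 1) ∂sphereMeasure = 0 := by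
  have h := integral_sphere_comp_isometry
    (signFlip ![LinearIsometryEquiv.neg ℝ, .refl ℝ ℝ, .refl ℝ ℝ])
    (fun x ↦ f (x 2) * (x 0 * x 1))
  simp [signFlip, LinearIsometryEquiv.piLpCongrRight_apply, integral_neg] at h
  linarith

theorem integral_zonal_mul_coord_zero (f : ℝ → ℝ) :
    ∫ p : S2, f (p.1 2) * p.1 0 ∂sphereMeasure = 0 := by
  have h := integral_sphere_comp_isometry
    (signFlip ![LinearIsometryEquiv.neg ℝ, .refl ℝ ℝ, .refl ℝ ℝ])
    (fun x ↦ f (x 2) * x 0)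
  simp [signFlip, LinearIsometryEquiv.piLpCongrRight_apply, integral_neg] at h
  linarith

theorem integral_zonal_mul_coord_one (f : ℝ → ℝ) :
    ∫ p : S2, f (p.1 2) * p.1 1 ∂sphereMeasure = 0 := by
  have h := integral_sphere_comp_isometry
    (signFlip ![.refl ℝ ℝ, LinearIsometryEquiv.neg ℝ, .refl ℝ ℝ])
    (fun x ↦ f (x 2) * x 1)
  simp [signFlip, LinearIsometryEquiv.piLpCongrRight_apply, integral_neg] at h
  linarith

theorem integral_zonal_mul_coord_sq_swap (f : ℝ → ℝ) :
    ∫ p : S2, f (p.1 2) * p.1 0 ^ 2 ∂sphereMeasure =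
      ∫ p : S2, f (p.1 2) * p.1 1 ^ 2 ∂sphereMeasure := by
  have h := integral_sphere_comp_isometry
    (LinearIsometryEquiv.piLpCongrLeft 2 ℝ ℝ (Equiv.swap 0 1))
    (fun x ↦ f (x 2) * x 1 ^ 2)
  rw [← h]
  simp [LinearIsometryEquiv.piLpCongrLeft_apply, Equiv.piCongrLeft'_apply,
    Equiv.swap_apply_of_ne_of_ne]

/-- The degree two case of the Funk–Hecke formula. -/
theorem integral_zonal_mul_inner_sq {f : ℝ → ℝ} (hf : Continuous f) {I₀ I₂ : ℝ}
    (h₀ : ∫ p : S2, f (p.1 2) ∂sphereMeasure = I₀)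
    (h₂ : ∫ p : S2, f (p.1 2) * p.1 2 ^ 2 ∂sphereMeasure = I₂) (q r : S2) :
    ∫ p, f (sphereInner p q) * sphereInner p r ^ 2 ∂sphereMeasure =
      sphereInner q r ^ 2 * I₂ + (1 - sphereInner q r ^ 2) / 2 * (I₀ - I₂) := by
  obtain ⟨L, hL⟩ := exists_isometry_apply_eq_pole q
  have hn : ‖L r‖ ^ 2 = 1 := by simp
  rw [EuclideanSpace.norm_sq_eq, Fin.sum_univ_three] at hn
  simp only [Real.norm_eq_abs, sq_abs] at hn
  have hqr : sphereInner q r = L r 2 := by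
    rw [sphereInner, ← L.inner_map_map, hL]
    simp [EuclideanSpace.inner_single_left]
  have hint : ∀ g : EuclideanSpace ℝ (Fin 3) → ℝ, Continuous g →
      Integrable (fun p : S2 ↦ f (p.1 2) * g p) sphereMeasure := fun g hg ↦
    integrable_sphere_of_continuous (by fun_prop)
  have hA : ∫ p : S2, f (p.1 2) * p.1 0 ^ 2 ∂sphereMeasure = (I₀ - I₂) / 2 := by
    have h : ∫ p : S2, (f (p.1 2) * p.1 0 ^ 2 + f (p.1 2) * p.1 1 ^ 2) ∂sphereMeasure =
        ∫ p : S2, (f (p.1 2) - f (p.1 2) * p.1 2 ^ 2) ∂sphereMeasure := by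
      congr 1; ext p
      linear_combination f (p.1 2) * sphere_sq_add_sq p
    rw [integral_add (hint (fun x ↦ x 0 ^ 2) (by fun_prop)) (hint (fun x ↦ x 1 ^ 2) (by fun_prop)),
      integral_sub (integrable_sphere_of_continuous (by fun_prop))
        (hint (fun x ↦ x 2 ^ 2) (by fun_prop)),
      h₀, h₂, ← integral_zonal_mul_coord_sq_swap] at h
    linarith
  have hB := (integral_zonal_mul_coord_sq_swap f).symm.trans hA
  have h01 := integral_zonal_mul_coord_zero_mul_coord_one f
  have h02 := integral_zonal_mul_coord_zero (fun t ↦ f t * t)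
  have h12 := integral_zonal_mul_coord_one (fun t ↦ f t * t)
  calc
    _ = ∫ p : S2, f (p.1 2) * inner (𝕜 := ℝ) p.1 (L r) ^ 2 ∂sphereMeasure := by
      rw [← integral_sphere_comp_isometry L (fun x ↦ f (x 2) * inner (𝕜 := ℝ) x (L r) ^ 2)]
      congr 1; ext p
      rw [sphereInner, sphereInner, ← L.inner_map_map, hL, L.inner_map_map p.1 r.1]
      simp [EuclideanSpace.inner_single_right]
    _ = ∫ p : S2, ((((((L r 0 ^ 2 * (f (p.1 2) * p.1 0 ^ 2) + L r 1 ^ 2 * (f (p.1 2) * p.1 1 ^ 2)) +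
          L r 2 ^ 2 * (f (p.1 2) * p.1 2 ^ 2)) +
          2 * L r 0 * L r 1 * (f (p.1 2) * (p.1 0 * p.1 1))) +
          2 * L r 0 * L r 2 * (f (p.1 2) * p.1 2 * p.1 0)) +
          2 * L r 1 * L r 2 * (f (p.1 2) * p.1 2 * p.1 1))) ∂sphereMeasure := by
      congr 1; ext p
      rw [PiLp.inner_apply, Fin.sum_univ_three]
      simp only [RCLike.inner_apply, conj_trivial]
      ring
    _ = _ := by
      rw [integral_add, integral_add, integral_add, integral_add, integral_add]
      · simp only [integral_const_mul]
        rw [hA, hB, h₂, h01, h02, h12, hqr]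
        linear_combination (I₀ - I₂) / 2 * hn
      all_goals exact integrable_sphere_of_continuous (by fun_prop)

/-- The kernel `3 (p·q)² - 1`, proportional to the zonal harmonic of degree two. -/
def zonalKernel (p q : S2) : ℝ := 3 * sphereInner p q ^ 2 - 1

theorem continuous_sphereInner : Continuous (fun z : S2 × S2 ↦ sphereInner z.1 z.2) := by
  unfold sphereInner; fun_prop

theorem continuous_onsagerKernel : Continuous (fun z : S2 × S2 ↦ onsagerKernel z.1 z.2) :=
  Real.continuous_sqrt.comp (continuous_const.sub (continuous_sphereInner.pow 2))

theorem continuous_zonalKernel : Continuous (fun z : S2 × S2 ↦ zonalKernel z.1 z.2) :=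
  ((continuous_sphereInner.pow 2).const_mul 3).sub continuous_const

theorem sphereInner_comm (p q : S2) : sphereInner p q = sphereInner q p := real_inner_comm _ _

theorem onsagerKernel_eq (p q : S2) : onsagerKernel p q = √(1 - sphereInner p q ^ 2) := rfl

theorem onsagerKernel_comm (p q : S2) : onsagerKernel p q = onsagerKernel q p := by
  simp only [onsagerKernel_eq, sphereInner_comm]

theorem zonalKernel_comm (p q : S2) : zonalKernel p q = zonalKernel q p := by
  simp only [zonalKernel, sphereInner_comm]

theorem sphereInner_self (p : S2) : sphereInner p p = 1 := by
  simp [sphereInner]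

theorem sphereInner_sq_le_one (p q : S2) : sphereInner p q ^ 2 ≤ 1 := by
  have h := abs_real_inner_le_norm p.1 q.1
  simp only [norm_eq_of_mem_sphere, mul_one] at h
  exact (sq_le_one_iff_abs_le_one _).2 h

theorem onsagerKernel_sq (p q : S2) : onsagerKernel p q ^ 2 = 1 - sphereInner p q ^ 2 :=
  Real.sq_sqrt (sub_nonneg.2 (sphereInner_sq_le_one p q))

theorem integral_onsagerKernel (p : S2) :
    ∫ q, onsagerKernel p q ∂sphereMeasure = Real.pi ^ 2 := by
  simp only [onsagerKernel_eq, sphereInner_comm p]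
  rw [integral_zonal (fun t ↦ √(1 - t ^ 2)), integral_sphere_sqrt]

theorem continuous_sphereInner_left (q : S2) : Continuous (fun p ↦ sphereInner p q) :=
  continuous_sphereInner.comp (Continuous.prodMk_left q)

theorem integral_zonal_mul_zonalKernel {f : ℝ → ℝ} (hf : Continuous f) {I₀ I₂ : ℝ}
    (h₀ : ∫ p : S2, f (p.1 2) ∂sphereMeasure = I₀)
    (h₂ : ∫ p : S2, f (p.1 2) * p.1 2 ^ 2 ∂sphereMeasure = I₂) (p r : S2) :
    ∫ q, f (sphereInner p q) * zonalKernel q r ∂sphereMeasure =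
      (3 * I₂ - I₀) / 2 * zonalKernel p r := by
  have h1 := integral_zonal_mul_inner_sq hf h₀ h₂ p r
  have h2 := (integral_zonal f p).trans h₀
  have hc := fun r ↦ continuous_sphereInner_left r
  have h3 : ∀ q, f (sphereInner p q) * zonalKernel q r =
      3 * (f (sphereInner q p) * sphereInner q r ^ 2) - f (sphereInner q p) := fun q ↦ by
    rw [zonalKernel, sphereInner_comm p q]; ring
  simp only [h3]
  rw [integral_sub (integrable_sphere_of_continuous (by fun_prop))
    (integrable_sphere_of_continuous (by fun_prop)), integral_const_mul, h1, h2, zonalKernel]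
  ring

theorem integral_onsagerKernel_mul_zonalKernel (p r : S2) :
    ∫ q, onsagerKernel p q * zonalKernel q r ∂sphereMeasure =
      -(Real.pi ^ 2 / 8) * zonalKernel p r := by
  simp only [onsagerKernel_eq]
  rw [integral_zonal_mul_zonalKernel (f := fun t ↦ √(1 - t ^ 2)) (by fun_prop)
    integral_sphere_sqrt (by simpa only [mul_comm] using integral_sphere_sq_mul_sqrt)]
  ring

theorem integral_zonalKernel (r : S2) : ∫ q, zonalKernel q r ∂sphereMeasure = 0 := by
  have h := integral_zonal_mul_zonalKernel (f := fun _ ↦ 1) continuous_const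
    integral_sphere_one (by simpa using integral_sphere_sq) r r
  simp only [one_mul] at h
  rw [h]; ring

theorem integral_zonalKernel_mul_zonalKernel (p r : S2) :
    ∫ q, zonalKernel p q * zonalKernel q r ∂sphereMeasure =
      8 * Real.pi / 5 * zonalKernel p r := by
  have hc : ∀ n, Integrable (fun p : S2 ↦ 3 * p.1 2 ^ n) sphereMeasure := fun n ↦
    integrable_sphere_of_continuous (by fun_prop)
  have hc' : ∀ n, Integrable (fun p : S2 ↦ p.1 2 ^ n) sphereMeasure := fun n ↦
    integrable_sphere_of_continuous (by fun_prop)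
  have h0 : ∫ p : S2, (3 * p.1 2 ^ 2 - 1) ∂sphereMeasure = 0 := by
    rw [integral_sub (hc 2) (integrable_const 1), integral_const_mul, integral_sphere_sq,
      integral_sphere_one]
    ring
  have h2 : ∫ p : S2, (3 * p.1 2 ^ 2 - 1) * p.1 2 ^ 2 ∂sphereMeasure = 16 * Real.pi / 15 := by
    have : ∀ p : S2, (3 * p.1 2 ^ 2 - 1) * p.1 2 ^ 2 = 3 * p.1 2 ^ 4 - p.1 2 ^ 2 := fun p ↦ by ring
    simp only [this]
    rw [integral_sub (hc 4) (hc' 2), integral_const_mul, integral_sphere_sq,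
      integral_sphere_pow_four]
    ring
  rw [show 8 * Real.pi / 5 = (3 * (16 * Real.pi / 15) - 0) / 2 by ring]
  exact integral_zonal_mul_zonalKernel (f := fun t ↦ 3 * t ^ 2 - 1) (by fun_prop) h0 h2 p r

/-- The Onsager kernel with its components of degree zero and two removed. -/
def residualKernel (p q : S2) : ℝ :=
  onsagerKernel p q - Real.pi / 4 + 5 * Real.pi / 64 * zonalKernel p q

theorem continuous_residualKernel : Continuous (fun z : S2 × S2 ↦ residualKernel z.1 z.2) :=
  (continuous_onsagerKernel.sub continuous_const).add (continuous_zonalKernel.const_mul _)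

theorem continuous_left {k : S2 → S2 → ℝ} (hk : Continuous (fun z : S2 × S2 ↦ k z.1 z.2)) (p : S2) :
    Continuous (k p) :=
  hk.comp (Continuous.prodMk_right p)

theorem integral_residualKernel_sq (p : S2) :
    ∫ q, residualKernel p q ^ 2 ∂sphereMeasure =
      8 * Real.pi / 3 - 69 / 256 * Real.pi ^ 3 := by
  have hK := continuous_left continuous_onsagerKernel p
  have hG := continuous_left continuous_zonalKernel p
  have e1 := integral_onsagerKernel p
  have e2 : ∫ q, zonalKernel p q ∂sphereMeasure = 0 := by
    simpa only [zonalKernel_comm p] using integral_zonalKernel p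
  have hGpp : zonalKernel p p = 2 := by rw [zonalKernel, sphereInner_self]; norm_num
  have e3 := integral_onsagerKernel_mul_zonalKernel p p
  have e4 := integral_zonalKernel_mul_zonalKernel p p
  simp only [zonalKernel_comm _ p, hGpp] at e3 e4
  have h : ∀ q, residualKernel p q ^ 2 =
      (((((2 / 3 + Real.pi ^ 2 / 16) + (-1 / 3 - 5 * Real.pi ^ 2 / 128) * zonalKernel p q) +
        (-(Real.pi / 2)) * onsagerKernel p q) +
        (5 * Real.pi / 32) * (onsagerKernel p q * zonalKernel p q)) +
        (25 * Real.pi ^ 2 / 4096) * (zonalKernel p q * zonalKernel p q)) := fun q ↦ by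
    have h1 := onsagerKernel_sq p q
    have h2 : sphereInner p q ^ 2 = (1 + zonalKernel p q) / 3 := by rw [zonalKernel]; ring
    rw [residualKernel]
    linear_combination h1 - h2
  have ec : ∫ _ : S2, (2 / 3 + Real.pi ^ 2 / 16) ∂sphereMeasure =
      (2 / 3 + Real.pi ^ 2 / 16) * (4 * Real.pi) := by
    rw [← integral_sphere_one, ← integral_const_mul, mul_one]
  simp only [h]
  rw [integral_add, integral_add, integral_add, integral_add]
  · simp only [integral_const_mul]
    rw [e1, e2, e3, e4, ec]
    ring
  all_goals exact integrable_sphere_of_continuous (by fun_prop)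

/-- The integral operator on the sphere with kernel `k`. -/
def kernelOp (k : S2 → S2 → ℝ) (χ : S2 → ℝ) (p : S2) : ℝ := ∫ q, k p q * χ q ∂sphereMeasure

theorem continuous_kernelOp {k : S2 → S2 → ℝ} (hk : Continuous (fun z : S2 × S2 ↦ k z.1 z.2))
    {χ : S2 → ℝ} (hχ : Integrable χ sphereMeasure) : Continuous (kernelOp k χ) := by
  obtain ⟨C, hC⟩ := isCompact_univ.exists_bound_of_continuousOn hk.continuousOn
  refine continuous_of_dominated (F := fun p q ↦ k p q * χ q) (bound := fun q ↦ C * ‖χ q‖)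
    (fun p ↦ ?_) (fun p ↦ ?_) (hχ.norm.const_mul C) (.of_forall fun q ↦ ?_)
  · exact (continuous_left hk p).aestronglyMeasurable.mul hχ.aestronglyMeasurable
  · refine .of_forall fun q ↦ ?_
    rw [norm_mul]
    exact mul_le_mul_of_nonneg_right (hC (p, q) (Set.mem_univ _)) (norm_nonneg _)
  · exact (hk.comp (Continuous.prodMk_left q)).mul continuous_const

theorem integrable_continuous_mul {g χ : S2 → ℝ} (hg : Continuous g)
    (hχ : Integrable χ sphereMeasure) : Integrable (fun q ↦ g q * χ q) sphereMeasure := by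
  obtain ⟨C, hC⟩ := isCompact_univ.exists_bound_of_continuousOn hg.continuousOn
  exact hχ.bdd_mul hg.aestronglyMeasurable (.of_forall fun q ↦ hC q (Set.mem_univ _))

theorem kernelOp_add {k : S2 → S2 → ℝ} (hk : Continuous (fun z : S2 × S2 ↦ k z.1 z.2))
    {χ ξ : S2 → ℝ} (hχ : Integrable χ sphereMeasure) (hξ : Integrable ξ sphereMeasure) (p : S2) :
    kernelOp k (fun q ↦ χ q + ξ q) p = kernelOp k χ p + kernelOp k ξ p := by
  simp only [kernelOp, mul_add]
  exact integral_add (integrable_continuous_mul (continuous_left hk p) hχ)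
    (integrable_continuous_mul (continuous_left hk p) hξ)

theorem kernelOp_const_mul (k : S2 → S2 → ℝ) (c : ℝ) (χ : S2 → ℝ) (p : S2) :
    kernelOp k (fun q ↦ c * χ q) p = c * kernelOp k χ p := by
  simp only [kernelOp, ← integral_const_mul]
  congr 1; ext q; ring

theorem integral_mul_kernelOp_comm {k : S2 → S2 → ℝ}
    (hk : Continuous (fun z : S2 × S2 ↦ k z.1 z.2)) (hs : ∀ p q, k p q = k q p)
    {χ ξ : S2 → ℝ} (hχ : Integrable χ sphereMeasure) (hξ : Integrable ξ sphereMeasure) :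
    ∫ p, χ p * kernelOp k ξ p ∂sphereMeasure = ∫ p, ξ p * kernelOp k χ p ∂sphereMeasure := by
  obtain ⟨C, hC⟩ := isCompact_univ.exists_bound_of_continuousOn hk.continuousOn
  have hi : Integrable (fun z : S2 × S2 ↦ k z.1 z.2 * (χ z.1 * ξ z.2))
      (sphereMeasure.prod sphereMeasure) :=
    (hχ.mul_prod hξ).bdd_mul hk.aestronglyMeasurable (.of_forall fun z ↦ hC z (Set.mem_univ _))
  have h := integral_integral_swap (f := fun p q ↦ k p q * (χ p * ξ q)) hi
  have e₁ : ∀ p, χ p * kernelOp k ξ p = ∫ q, k p q * (χ p * ξ q) ∂sphereMeasure := fun p ↦ by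
    rw [kernelOp, ← integral_const_mul]
    congr 1; ext q; ring
  have e₂ : ∀ q, ξ q * kernelOp k χ q = ∫ p, k p q * (χ p * ξ q) ∂sphereMeasure := fun q ↦ by
    rw [kernelOp, ← integral_const_mul]
    congr 1; ext p; rw [hs q p]; ring
  simp only [e₁, e₂]
  exact h

theorem kernelOp_kernelOp_zonalKernel {k : S2 → S2 → ℝ} {c : ℝ}
    (hk : Continuous (fun z : S2 × S2 ↦ k z.1 z.2))
    (hc : ∀ p r, ∫ q, k p q * zonalKernel q r ∂sphereMeasure = c * zonalKernel p r)
    {φ : S2 → ℝ} (hφ : Integrable φ sphereMeasure) (p : S2) :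
    kernelOp k (kernelOp zonalKernel φ) p = c * kernelOp zonalKernel φ p := by
  have h := integral_mul_kernelOp_comm continuous_zonalKernel zonalKernel_comm
    (integrable_sphere_of_continuous (continuous_left hk p)) hφ
  rw [kernelOp, h]
  have h1 : ∀ r, kernelOp zonalKernel (k p) r = c * zonalKernel p r := fun r ↦ by
    rw [← hc, kernelOp]
    congr 1; ext q; rw [zonalKernel_comm]; ring
  simp only [h1]
  rw [kernelOp, ← integral_const_mul]
  congr 1; ext r; ring

theorem kernelOp_residualKernel_sq_le {ψ : S2 → ℝ} (hψ : MemLp ψ 2 sphereMeasure) (p : S2) :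
    kernelOp residualKernel ψ p ^ 2 ≤
      (8 * Real.pi / 3 - 69 / 256 * Real.pi ^ 3) * ∫ q, ψ q ^ 2 ∂sphereMeasure := by
  have hR := continuous_left continuous_residualKernel p
  have hi1 : Integrable (fun q ↦ residualKernel p q ^ 2) sphereMeasure :=
    integrable_sphere_of_continuous (by fun_prop)
  have hi2 := integrable_continuous_mul hR (hψ.integrable one_le_two)
  have key : ∀ t : ℝ, 0 ≤ (∫ q, residualKernel p q ^ 2 ∂sphereMeasure) * (t * t) +
      (2 * kernelOp residualKernel ψ p) * t + ∫ q, ψ q ^ 2 ∂sphereMeasure := fun t ↦ by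
    have h : 0 ≤ ∫ q, (t * residualKernel p q + ψ q) ^ 2 ∂sphereMeasure :=
      integral_nonneg fun q ↦ sq_nonneg _
    have h' : ∀ q, (t * residualKernel p q + ψ q) ^ 2 =
        ((t * t) * residualKernel p q ^ 2 + (2 * t) * (residualKernel p q * ψ q)) + ψ q ^ 2 :=
      fun q ↦ by ring
    simp only [h'] at h
    rw [integral_add ((hi1.const_mul _).fun_add (hi2.const_mul _)) hψ.integrable_sq,
      integral_add (hi1.const_mul _) (hi2.const_mul _), integral_const_mul, integral_const_mul] at h
    rw [kernelOp]
    linarith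
  have hd := discrim_le_zero key
  rw [discrim, integral_residualKernel_sq] at hd
  linarith

theorem residual_bound_le :
    4 * Real.pi * (8 * Real.pi / 3 - 69 / 256 * Real.pi ^ 3) ≤ (Real.pi ^ 2 / 8) ^ 2 := by
  have h : 9.8 ≤ Real.pi ^ 2 := by nlinarith [Real.pi_gt_d2]
  nlinarith [sq_nonneg Real.pi]

theorem integral_mul_kernelOp_residualKernel_ge {ψ : S2 → ℝ} (hψ : MemLp ψ 2 sphereMeasure) :
    -(Real.pi ^ 2 / 8) * ∫ q, ψ q ^ 2 ∂sphereMeasure ≤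
      ∫ p, ψ p * kernelOp residualKernel ψ p ∂sphereMeasure := by
  set N := ∫ q, ψ q ^ 2 ∂sphereMeasure with hN
  set θ := Real.pi ^ 2 / 8 with hθ
  have hθ0 : 0 < θ := by positivity
  have hN0 : 0 ≤ N := integral_nonneg fun q ↦ sq_nonneg _
  have hψ1 := hψ.integrable one_le_two
  have hT := continuous_kernelOp continuous_residualKernel hψ1
  have hi : Integrable (fun p ↦ ψ p * kernelOp residualKernel ψ p) sphereMeasure := by
    simpa only [mul_comm] using integrable_continuous_mul hT hψ1
  have hpt : ∀ p, -(θ / 2) * ψ p ^ 2 +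
      (-(8 * Real.pi / 3 - 69 / 256 * Real.pi ^ 3) * N / (2 * θ)) * 1 ≤
      ψ p * kernelOp residualKernel ψ p := fun p ↦ by
    have h1 := kernelOp_residualKernel_sq_le hψ p
    have h2 : -(θ / 2) * ψ p ^ 2 - kernelOp residualKernel ψ p ^ 2 / (2 * θ) ≤
        ψ p * kernelOp residualKernel ψ p := by
      have : 0 ≤ (θ * ψ p + kernelOp residualKernel ψ p) ^ 2 / (2 * θ) := by positivity
      have e : (θ * ψ p + kernelOp residualKernel ψ p) ^ 2 / (2 * θ) = θ / 2 * ψ p ^ 2 +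
        ψ p * kernelOp residualKernel ψ p + kernelOp residualKernel ψ p ^ 2 / (2 * θ) := by
        field_simp; ring
      linarith
    have h3 := div_le_div_of_nonneg_right h1 (by positivity : 0 ≤ 2 * θ)
    have e : -(8 * Real.pi / 3 - 69 / 256 * Real.pi ^ 3) * N / (2 * θ) * 1 =
        -((8 * Real.pi / 3 - 69 / 256 * Real.pi ^ 3) * N / (2 * θ)) := by ring
    rw [e]
    linarith
  have h := integral_mono ((hψ.integrable_sq.const_mul (-(θ / 2))).add
    ((integrable_const (1 : ℝ)).const_mul _)) hi hpt
  simp only [Pi.add_apply] at h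
  rw [integral_add (hψ.integrable_sq.const_mul (-(θ / 2)))
    ((integrable_const (1 : ℝ)).const_mul _), integral_const_mul, integral_const_mul,
    integral_sphere_one, ← hN] at h
  refine le_trans ?_ h
  have h4 : 4 * Real.pi * (8 * Real.pi / 3 - 69 / 256 * Real.pi ^ 3) * N / (2 * θ) ≤
      θ ^ 2 * N / (2 * θ) := by
    gcongr; exact residual_bound_le
  have h5 : θ ^ 2 * N / (2 * θ) = θ / 2 * N := by field_simp
  have h6 : -(8 * Real.pi / 3 - 69 / 256 * Real.pi ^ 3) * N / (2 * θ) * (4 * Real.pi) =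
    -(4 * Real.pi * (8 * Real.pi / 3 - 69 / 256 * Real.pi ^ 3) * N / (2 * θ)) := by ring
  rw [h6]
  linarith

theorem integral_kernelOp_zonalKernel {φ : S2 → ℝ} (hφ : Integrable φ sphereMeasure) :
    ∫ p, kernelOp zonalKernel φ p ∂sphereMeasure = 0 := by
  have h := integral_mul_kernelOp_comm continuous_zonalKernel zonalKernel_comm
    (integrable_const 1) hφ
  have h1 : ∀ p, kernelOp zonalKernel (fun _ ↦ 1) p = 0 := fun p ↦ by
    simpa only [kernelOp, mul_one, zonalKernel_comm p] using integral_zonalKernel p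
  simpa only [one_mul, h1, mul_zero, integral_zero] using h

theorem kernelOp_residualKernel_eq {ψ : S2 → ℝ} (hψ : Integrable ψ sphereMeasure)
    (h0 : ∫ p, ψ p ∂sphereMeasure = 0) (hG : ∀ p, kernelOp zonalKernel ψ p = 0) (p : S2) :
    kernelOp residualKernel ψ p = kernelOp onsagerKernel ψ p := by
  have hK := integrable_continuous_mul (continuous_left continuous_onsagerKernel p) hψ
  have hZ := integrable_continuous_mul (continuous_left continuous_zonalKernel p) hψ
  have h : ∀ q, residualKernel p q * ψ q = (onsagerKernel p q * ψ q - Real.pi / 4 * ψ q) +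
      5 * Real.pi / 64 * (zonalKernel p q * ψ q) := fun q ↦ by rw [residualKernel]; ring
  have hG' := hG p
  rw [kernelOp] at hG'
  simp only [kernelOp, h]
  have hS : Integrable (fun q ↦ onsagerKernel p q * ψ q - Real.pi / 4 * ψ q) sphereMeasure :=
    hK.sub (hψ.const_mul _)
  rw [integral_add hS (hZ.const_mul _), integral_sub hK (hψ.const_mul _),
    integral_const_mul, integral_const_mul, h0, hG']
  ring

/-- The Onsager interaction is bounded below by `-π²/8` on functions of mean zero. -/
theorem integral_mul_kernelOp_onsagerKernel_ge {φ : S2 → ℝ} (hφ : MemLp φ 2 sphereMeasure)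
    (h0 : ∫ p, φ p ∂sphereMeasure = 0) :
    -(Real.pi ^ 2 / 8) * ∫ q, φ q ^ 2 ∂sphereMeasure ≤
      ∫ p, φ p * kernelOp onsagerKernel φ p ∂sphereMeasure := by
  have hφ1 := hφ.integrable one_le_two
  have hcG := continuous_kernelOp continuous_zonalKernel hφ1
  set φ₂ : S2 → ℝ := fun p ↦ 5 / (8 * Real.pi) * kernelOp zonalKernel φ p with hφ₂
  have hc₂ : Continuous φ₂ := hcG.const_mul _
  have hi₂ : Integrable φ₂ sphereMeasure := integrable_sphere_of_continuous hc₂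
  have hm₂ : MemLp φ₂ 2 sphereMeasure :=
    hc₂.memLp_of_hasCompactSupport (HasCompactSupport.of_compactSpace _)
  set ψ : S2 → ℝ := fun p ↦ φ p + (-1) * φ₂ p with hψdef
  have hψ : MemLp ψ 2 sphereMeasure := hφ.add (hm₂.const_mul (-1))
  have hψ1 := hψ.integrable one_le_two
  have hpi : Real.pi ≠ 0 := Real.pi_ne_zero
  have hKφ₂ : ∀ p, kernelOp onsagerKernel φ₂ p = -(Real.pi ^ 2 / 8) * φ₂ p := fun p ↦ by
    rw [hφ₂, kernelOp_const_mul, kernelOp_kernelOp_zonalKernel continuous_onsagerKernel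
      integral_onsagerKernel_mul_zonalKernel hφ1]
    ring
  have hGφ₂ : ∀ p, kernelOp zonalKernel φ₂ p = kernelOp zonalKernel φ p := fun p ↦ by
    rw [hφ₂, kernelOp_const_mul, kernelOp_kernelOp_zonalKernel continuous_zonalKernel
      integral_zonalKernel_mul_zonalKernel hφ1]
    field_simp
  have hGψ : ∀ p, kernelOp zonalKernel ψ p = 0 := fun p ↦ by
    rw [hψdef, kernelOp_add continuous_zonalKernel hφ1 (hi₂.const_mul _), kernelOp_const_mul,
      hGφ₂]
    ring
  have h0₂ : ∫ p, φ₂ p ∂sphereMeasure = 0 := by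
    simp only [hφ₂]
    rw [integral_const_mul, integral_kernelOp_zonalKernel hφ1, mul_zero]
  have h0ψ : ∫ p, ψ p ∂sphereMeasure = 0 := by
    simp only [hψdef]
    rw [integral_add hφ1 (hi₂.const_mul _), integral_const_mul, h0, h0₂]; ring
  have horth : ∫ p, ψ p * φ₂ p ∂sphereMeasure = 0 := by
    have h := integral_mul_kernelOp_comm continuous_zonalKernel zonalKernel_comm hφ1 hψ1
    simp only [hGψ, mul_zero, integral_zero] at h
    have h' : ∀ p, ψ p * φ₂ p = 5 / (8 * Real.pi) * (ψ p * kernelOp zonalKernel φ p) := fun p ↦ by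
      simp only [hφ₂]; ring
    simp only [h']
    rw [integral_const_mul, ← h, mul_zero]
  have hψφ₂ : Integrable (fun p ↦ ψ p * φ₂ p) sphereMeasure := by
    simpa only [mul_comm] using integrable_continuous_mul hc₂ hψ1
  have hφsq : ∫ p, φ p ^ 2 ∂sphereMeasure =
      ∫ p, ψ p ^ 2 ∂sphereMeasure + ∫ p, φ₂ p ^ 2 ∂sphereMeasure := by
    have h : ∀ p, φ p ^ 2 = (ψ p ^ 2 + φ₂ p ^ 2) + 2 * (ψ p * φ₂ p) := fun p ↦ by
      simp only [hψdef]; ring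
    simp only [h]
    rw [integral_add (hψ.integrable_sq.fun_add hm₂.integrable_sq) (hψφ₂.const_mul 2),
      integral_add hψ.integrable_sq hm₂.integrable_sq, integral_const_mul, horth]
    ring
  have hcT := continuous_kernelOp continuous_onsagerKernel hψ1
  have hiT : Integrable (fun p ↦ ψ p * kernelOp onsagerKernel ψ p) sphereMeasure := by
    simpa only [mul_comm] using integrable_continuous_mul hcT hψ1
  have hcross : ∫ p, φ₂ p * kernelOp onsagerKernel ψ p ∂sphereMeasure = 0 := by
    rw [integral_mul_kernelOp_comm continuous_onsagerKernel onsagerKernel_comm hi₂ hψ1]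
    have h : ∀ p, ψ p * kernelOp onsagerKernel φ₂ p = -(Real.pi ^ 2 / 8) * (ψ p * φ₂ p) :=
      fun p ↦ by rw [hKφ₂]; ring
    simp only [h]
    rw [integral_const_mul, horth, mul_zero]
  have hquad : ∫ p, φ p * kernelOp onsagerKernel φ p ∂sphereMeasure =
      ∫ p, ψ p * kernelOp onsagerKernel ψ p ∂sphereMeasure +
        -(Real.pi ^ 2 / 8) * ∫ p, φ₂ p ^ 2 ∂sphereMeasure := by
    have hK : ∀ p, kernelOp onsagerKernel φ p =
        kernelOp onsagerKernel ψ p + -(Real.pi ^ 2 / 8) * φ₂ p := fun p ↦ by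
      rw [hψdef, kernelOp_add continuous_onsagerKernel hφ1 (hi₂.const_mul _), kernelOp_const_mul,
        hKφ₂]
      ring
    have h : ∀ p, φ p * kernelOp onsagerKernel φ p =
        ((ψ p * kernelOp onsagerKernel ψ p + φ₂ p * kernelOp onsagerKernel ψ p) +
          -(Real.pi ^ 2 / 8) * (ψ p * φ₂ p)) + -(Real.pi ^ 2 / 8) * φ₂ p ^ 2 := fun p ↦ by
      rw [hK]
      simp only [hψdef]; ring
    have hi₃ : Integrable (fun p ↦ φ₂ p * kernelOp onsagerKernel ψ p) sphereMeasure :=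
      integrable_sphere_of_continuous (by fun_prop)
    simp only [h]
    rw [integral_add ((hiT.fun_add hi₃).fun_add (hψφ₂.const_mul _)) (hm₂.integrable_sq.const_mul _),
      integral_add (hiT.fun_add hi₃) (hψφ₂.const_mul _), integral_add hiT hi₃, hcross,
      integral_const_mul, horth, integral_const_mul]
    ring
  have hmain := integral_mul_kernelOp_residualKernel_ge hψ
  simp only [kernelOp_residualKernel_eq hψ1 h0ψ hGψ] at hmain
  rw [hquad, hφsq, mul_add]
  linarith

theorem one_add_mul_log_le {s : ℝ} (hs : -1 < s) : (1 + s) * Real.log (1 + s) - s ≤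
    max (s ^ 2 / 2) (s ^ 2 / (2 + s)) ∧
    min (s ^ 2 / 2) (s ^ 2 / (2 + s)) ≤ (1 + s) * Real.log (1 + s) - s := by
  have hpos : 0 < 1 + s := by linarith
  have hsinh := Real.sinh_log hpos
  have hmul : (1 + s) * Real.sinh (Real.log (1 + s)) = s + s ^ 2 / 2 := by
    rw [hsinh]; field_simp; ring
  rcases le_total 0 s with h | h
  · have h1 : Real.log (1 + s) ≤ Real.sinh (Real.log (1 + s)) :=
      Real.self_le_sinh_iff.2 (Real.log_nonneg (by linarith))
    have h2 := Real.le_log_one_add_of_nonneg h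
    have h3 := mul_le_mul_of_nonneg_left h1 hpos.le
    have h4 := mul_le_mul_of_nonneg_left h2 hpos.le
    have h5 : (1 + s) * (2 * s / (s + 2)) - s = s ^ 2 / (2 + s) := by
      have : s + 2 ≠ 0 := by linarith
      have : 2 + s ≠ 0 := by linarith
      field_simp; ring
    exact ⟨le_max_of_le_left (by linarith), min_le_of_right_le (by linarith)⟩
  · have h1 : Real.sinh (Real.log (1 + s)) ≤ Real.log (1 + s) :=
      Real.sinh_le_self_iff.2 (Real.log_nonpos hpos.le (by linarith))
    have h2 := Real.le_log_one_add_of_nonneg (x := -s / (1 + s))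
      (div_nonneg (by linarith) hpos.le)
    have e1 : 1 + -s / (1 + s) = (1 + s)⁻¹ := by field_simp; ring
    rw [e1, Real.log_inv] at h2
    have h3 := mul_le_mul_of_nonneg_left h1 hpos.le
    have h4 := mul_le_mul_of_nonneg_left h2 hpos.le
    have h5 : (1 + s) * (2 * (-s / (1 + s)) / (-s / (1 + s) + 2)) + s = -(s ^ 2 / (2 + s)) := by
      have h6 : 2 + s ≠ 0 := by linarith
      have h7 : -s / (1 + s) + 2 = (2 + s) / (1 + s) := by field_simp; ring
      rw [h7]
      field_simp; ring
    exact ⟨le_max_of_le_right (by linarith), min_le_of_left_le (by linarith)⟩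

theorem mul_log_taylor_bounds {c η y : ℝ} (hc : 0 < c) (hη : η < 1)
    (hy : |y| ≤ η * c) :
    1 / (c * (2 + η)) * y ^ 2 ≤
      (c + y) * Real.log (c + y) - c * Real.log c - (1 + Real.log c) * y ∧
    (c + y) * Real.log (c + y) - c * Real.log c - (1 + Real.log c) * y ≤
      1 / (c * (2 - η)) * y ^ 2 := by
  obtain ⟨s, rfl⟩ : ∃ s, y = c * s := ⟨y / c, by field_simp⟩
  rw [abs_mul, abs_of_pos hc, mul_comm η] at hy
  have hs := abs_le.1 (le_of_mul_le_mul_left hy hc)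
  have hη0 : 0 ≤ η := by linarith
  have hs1 : 0 < 1 + s := by linarith
  obtain ⟨h1, h2⟩ := one_add_mul_log_le (s := s) (by linarith)
  have e : (c + c * s) * Real.log (c + c * s) - c * Real.log c - (1 + Real.log c) * (c * s) =
      c * ((1 + s) * Real.log (1 + s) - s) := by
    rw [show c + c * s = c * (1 + s) by ring, Real.log_mul hc.ne' hs1.ne']
    ring
  have e1 : ∀ a : ℝ, 1 / (c * a) * (c * s) ^ 2 = c * (s ^ 2 / a) := fun a ↦ by
    field_simp
  rw [e, e1, e1]
  constructor
  · refine mul_le_mul_of_nonneg_left (le_trans (le_min ?_ ?_) h2) hc.le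
    · exact div_le_div_of_nonneg_left (sq_nonneg _) (by norm_num) (by linarith)
    · exact div_le_div_of_nonneg_left (sq_nonneg _) (by linarith) (by linarith)
  · refine mul_le_mul_of_nonneg_left (h1.trans (max_le ?_ ?_)) hc.le
    · exact div_le_div_of_nonneg_left (sq_nonneg _) (by linarith) (by linarith)
    · exact div_le_div_of_nonneg_left (sq_nonneg _) (by linarith) (by linarith)

theorem integral_interaction_eq {φ : S2 → ℝ} (c : ℝ) (hφ : Integrable φ sphereMeasure)
    (h0 : ∫ p, φ p ∂sphereMeasure = 0) :
    ∫ p, (∫ q, onsagerKernel p q * (c + φ p) * (c + φ q) ∂sphereMeasure) ∂sphereMeasure =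
      4 * Real.pi ^ 3 * c ^ 2 + ∫ p, φ p * kernelOp onsagerKernel φ p ∂sphereMeasure := by
  have h1 : ∀ p, kernelOp onsagerKernel (fun _ ↦ 1) p = Real.pi ^ 2 := fun p ↦ by
    simpa only [kernelOp, mul_one] using integral_onsagerKernel p
  have hT := continuous_kernelOp continuous_onsagerKernel hφ
  have hK : ∀ p, ∫ q, onsagerKernel p q * (c + φ p) * (c + φ q) ∂sphereMeasure =
      ((Real.pi ^ 2 * c ^ 2 * 1 + Real.pi ^ 2 * c * φ p) + c * kernelOp onsagerKernel φ p) +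
        φ p * kernelOp onsagerKernel φ p := fun p ↦ by
    have h : ∀ q, onsagerKernel p q * (c + φ p) * (c + φ q) =
        (c + φ p) * (c * onsagerKernel p q + onsagerKernel p q * φ q) := fun q ↦ by ring
    simp only [h]
    have hKc := continuous_left continuous_onsagerKernel p
    rw [integral_const_mul, integral_add
      ((integrable_sphere_of_continuous hKc).const_mul c)
      (integrable_continuous_mul hKc hφ), integral_const_mul,
      integral_onsagerKernel, kernelOp]
    ring
  have hmean : ∫ p, kernelOp onsagerKernel φ p ∂sphereMeasure = 0 := by
    have h := integral_mul_kernelOp_comm continuous_onsagerKernel onsagerKernel_comm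
      (integrable_const 1) hφ
    simpa only [one_mul, h1, integral_mul_const, h0, zero_mul] using h
  have i1 : Integrable (fun _ : S2 ↦ Real.pi ^ 2 * c ^ 2 * 1) sphereMeasure := integrable_const _
  have i2 : Integrable (fun p : S2 ↦ Real.pi ^ 2 * c * φ p) sphereMeasure := hφ.const_mul _
  have i3 : Integrable (fun p : S2 ↦ c * kernelOp onsagerKernel φ p) sphereMeasure :=
    (integrable_sphere_of_continuous hT).const_mul _
  have i4 : Integrable (fun p : S2 ↦ φ p * kernelOp onsagerKernel φ p) sphereMeasure := by
    simpa only [mul_comm] using integrable_continuous_mul hT hφ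
  simp only [hK]
  rw [integral_add ((i1.fun_add i2).fun_add i3) i4, integral_add (i1.fun_add i2) i3,
    integral_add i1 i2, integral_const_mul, integral_const_mul, integral_const_mul, h0, hmean,
    integral_sphere_one]
  ring

theorem onsagerF_const_add_bounds {φ : S2 → ℝ} {c η lam : ℝ} (hc : 0 < c) (hη0 : 0 ≤ η)
    (hη : η < 1) (hlam : 0 ≤ lam) (hm : Measurable φ)
    (hb : ∀ᵐ p ∂sphereMeasure, |φ p| ≤ η * c) (h0 : ∫ p, φ p ∂sphereMeasure = 0) :
    lam * (1 / (c * (2 + η)) * ∫ p, φ p ^ 2 ∂sphereMeasure) +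
        1 / 2 * ∫ p, φ p * kernelOp onsagerKernel φ p ∂sphereMeasure ≤
      onsagerF onsagerKernel lam (fun p ↦ c + φ p) - onsagerF onsagerKernel lam (fun _ ↦ c) ∧
    onsagerF onsagerKernel lam (fun p ↦ c + φ p) - onsagerF onsagerKernel lam (fun _ ↦ c) ≤
      lam * (1 / (c * (2 - η)) * ∫ p, φ p ^ 2 ∂sphereMeasure) +
        1 / 2 * ∫ p, φ p * kernelOp onsagerKernel φ p ∂sphereMeasure := by
  have hφ : MemLp φ 2 sphereMeasure :=
    MemLp.of_bound hm.aestronglyMeasurable (η * c) hb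
  have hφ1 := hφ.integrable one_le_two
  set D : S2 → ℝ := fun p ↦
    (c + φ p) * Real.log (c + φ p) - c * Real.log c - (1 + Real.log c) * φ p with hD
  have hDb : ∀ᵐ p ∂sphereMeasure, 1 / (c * (2 + η)) * φ p ^ 2 ≤ D p ∧
      D p ≤ 1 / (c * (2 - η)) * φ p ^ 2 := by
    filter_upwards [hb] with p hp using mul_log_taylor_bounds hc hη hp
  have hDm : Measurable D := by fun_prop
  have hDi : Integrable D sphereMeasure := by
    refine (hφ.integrable_sq.const_mul (1 / (c * (2 - η)))).mono' hDm.aestronglyMeasurable ?_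
    filter_upwards [hDb] with p hp
    rw [Real.norm_eq_abs, abs_of_nonneg (le_trans (by positivity) hp.1)]
    exact hp.2
  have hlog : ∫ p, (c + φ p) * Real.log (c + φ p) ∂sphereMeasure =
      ∫ _ : S2, c * Real.log c ∂sphereMeasure + ∫ p, D p ∂sphereMeasure := by
    have h : ∀ p, (c + φ p) * Real.log (c + φ p) =
        (c * Real.log c + (1 + Real.log c) * φ p) + D p := fun p ↦ by
      simp only [hD]; ring
    simp only [h]
    rw [integral_add ((integrable_const _).fun_add (hφ1.const_mul _)) hDi,
      integral_add (integrable_const _) (hφ1.const_mul _),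
      integral_const_mul (1 + Real.log c), h0]
    ring
  have hint0 := integral_interaction_eq (φ := fun _ ↦ 0) c (integrable_const 0) (by simp)
  simp only [add_zero, zero_mul, integral_zero] at hint0
  have hF : onsagerF onsagerKernel lam (fun p ↦ c + φ p) -
      onsagerF onsagerKernel lam (fun _ ↦ c) = lam * ∫ p, D p ∂sphereMeasure +
        1 / 2 * ∫ p, φ p * kernelOp onsagerKernel φ p ∂sphereMeasure := by
    rw [onsagerF, onsagerF, hlog, integral_interaction_eq c hφ1 h0, hint0]
    ring
  have hlo := integral_mono_ae (hφ.integrable_sq.const_mul (1 / (c * (2 + η)))) hDi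
    (hDb.mono fun p hp ↦ hp.1)
  have hhi := integral_mono_ae hDi (hφ.integrable_sq.const_mul (1 / (c * (2 - η))))
    (hDb.mono fun p hp ↦ hp.2)
  rw [integral_const_mul] at hlo hhi
  rw [hF]
  exact ⟨by gcongr, by gcongr⟩

theorem abs_zonalKernel_le (p q : S2) : |zonalKernel p q| ≤ 2 := by
  have h := sphereInner_sq_le_one p q
  have h' := sq_nonneg (sphereInner p q)
  rw [abs_le, zonalKernel]
  constructor <;> linarith

theorem onsagerF_uniform_le {lam : ℝ} (hlam : Real.pi / 32 < lam) :
    ∃ ε > (0 : ℝ), ∀ ρ : S2 → ℝ, IsProbDensity ρ →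
      eLpNorm (fun p => ρ p - 1 / (4 * Real.pi)) ⊤ sphereMeasure < ENNReal.ofReal ε →
      onsagerF onsagerKernel lam (fun _ => 1 / (4 * Real.pi)) ≤ onsagerF onsagerKernel lam ρ := by
  have hpi := Real.pi_pos
  set c : ℝ := 1 / (4 * Real.pi) with hc
  have hc0 : 0 < c := by positivity
  have hlam0 : 0 < lam := lt_trans (by positivity) hlam
  obtain ⟨η, hη0, hη1, hη⟩ : ∃ η : ℝ, 0 < η ∧ η < 1 ∧ Real.pi * (2 + η) ≤ 64 * lam := by
    refine ⟨min (1 / 2) (64 * lam / Real.pi - 2), lt_min (by norm_num) ?_,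
      (min_le_left _ _).trans_lt (by norm_num), ?_⟩
    · rw [sub_pos, lt_div_iff₀ hpi]; linarith
    · calc _ ≤ Real.pi * (2 + (64 * lam / Real.pi - 2)) := by gcongr; exact min_le_right _ _
        _ = 64 * lam := by field_simp; ring
  refine ⟨η * c, by positivity, fun ρ hρ hnorm ↦ ?_⟩
  obtain ⟨hm, -, h1⟩ := hρ
  set φ : S2 → ℝ := fun p ↦ ρ p - c with hφ
  have hφm : Measurable φ := hm.sub_const c
  have hb : ∀ᵐ p ∂sphereMeasure, |φ p| ≤ η * c := by
    rw [eLpNorm_exponent_top] at hnorm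
    filter_upwards [ae_le_eLpNormEssSup (f := φ) (μ := sphereMeasure)] with p hp
    have h := hp.trans hnorm.le
    rw [← ofReal_norm] at h
    exact (ENNReal.ofReal_le_ofReal_iff (by positivity)).1 h
  have hρi : Integrable ρ sphereMeasure := by
    by_contra h
    rw [integral_undef h] at h1
    exact zero_ne_one h1
  have h0 : ∫ p, φ p ∂sphereMeasure = 0 := by
    have hcc : ∫ _ : S2, c ∂sphereMeasure = 1 := by
      have : ∫ _ : S2, c * 1 ∂sphereMeasure = c * (4 * Real.pi) := by
        rw [integral_const_mul, integral_sphere_one]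
      rw [mul_one] at this
      rw [this, hc]; field_simp
    rw [integral_sub hρi (integrable_const _), h1, hcc, sub_self]
  have hmem : MemLp φ 2 sphereMeasure := MemLp.of_bound hφm.aestronglyMeasurable (η * c) hb
  have hq := integral_mul_kernelOp_onsagerKernel_ge hmem h0
  have hF := (onsagerF_const_add_bounds hc0 hη0.le hη1 hlam0.le hφm hb h0).1
  have hN : 0 ≤ ∫ p, φ p ^ 2 ∂sphereMeasure := integral_nonneg fun p ↦ sq_nonneg _
  have hcoef : Real.pi ^ 2 / 16 ≤ lam * (1 / (c * (2 + η))) := by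
    have : lam * (1 / (c * (2 + η))) = 4 * Real.pi * lam / (2 + η) := by rw [hc]; field_simp
    rw [this, le_div_iff₀ (by positivity)]
    nlinarith
  have hco := mul_le_mul_of_nonneg_right hcoef hN
  have hρφ : (fun p ↦ c + φ p) = ρ := by ext p; simp [hφ]
  rw [hρφ] at hF
  linarith

theorem exists_onsagerF_lt_uniform {lam : ℝ} (hlam0 : 0 < lam) (hlam : lam < Real.pi / 32)
    {ε : ℝ} (hε : 0 < ε) :
    ∃ ρ : S2 → ℝ, IsProbDensity ρ ∧
      eLpNorm (fun p => ρ p - 1 / (4 * Real.pi)) ⊤ sphereMeasure < ENNReal.ofReal ε ∧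
      onsagerF onsagerKernel lam ρ < onsagerF onsagerKernel lam (fun _ => 1 / (4 * Real.pi)) := by
  have hpi := Real.pi_pos
  set c : ℝ := 1 / (4 * Real.pi) with hc
  have hc0 : 0 < c := by positivity
  obtain ⟨η, hη0, hη1, hη, hηε⟩ :
      ∃ η : ℝ, 0 < η ∧ η < 1 ∧ 64 * lam < Real.pi * (2 - η) ∧ η * c < ε := by
    have hgap : 0 < 2 - 64 * lam / Real.pi := by
      rw [sub_pos, div_lt_iff₀ hpi]; linarith
    obtain ⟨η, hη0, hη⟩ := exists_between (lt_min one_pos (lt_min hgap (div_pos hε hc0)))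
    obtain ⟨hη1, hη2, hη3⟩ : η < 1 ∧ η < 2 - 64 * lam / Real.pi ∧ η < ε / c := by
      simpa only [lt_min_iff] using hη
    refine ⟨η, hη0, hη1, ?_, (lt_div_iff₀ hc0).1 hη3⟩
    have : 64 * lam / Real.pi < 2 - η := by linarith
    rw [div_lt_iff₀ hpi] at this
    linarith
  let e : S2 := ⟨EuclideanSpace.single 2 1, by simp⟩
  set φ : S2 → ℝ := fun p ↦ η * c / 2 * zonalKernel p e with hφ
  have hφc : Continuous φ :=
    (continuous_zonalKernel.comp (Continuous.prodMk_left e)).const_mul _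
  have hb : ∀ p, |φ p| ≤ η * c := fun p ↦ by
    rw [hφ, abs_mul, abs_of_nonneg (by positivity)]
    calc _ ≤ η * c / 2 * 2 := by gcongr; exact abs_zonalKernel_le p e
      _ = η * c := by ring
  have hφi := integrable_sphere_of_continuous hφc
  have h0 : ∫ p, φ p ∂sphereMeasure = 0 := by
    simp only [hφ]
    rw [integral_const_mul, integral_zonalKernel, mul_zero]
  have hN : 0 < ∫ p, φ p ^ 2 ∂sphereMeasure := by
    have h := integral_zonalKernel_mul_zonalKernel e e
    have hee : zonalKernel e e = 2 := by rw [zonalKernel, sphereInner_self]; norm_num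
    have h' : ∀ p, φ p ^ 2 = (η * c / 2) ^ 2 * (zonalKernel e p * zonalKernel p e) := fun p ↦ by
      rw [hφ, zonalKernel_comm e p]; ring
    simp only [h']
    rw [integral_const_mul, h, hee]
    positivity
  have hK : ∀ p, φ p * kernelOp onsagerKernel φ p = -(Real.pi ^ 2 / 8) * φ p ^ 2 := fun p ↦ by
    have : kernelOp onsagerKernel φ p = -(Real.pi ^ 2 / 8) * φ p := by
      rw [hφ, kernelOp_const_mul, kernelOp, integral_onsagerKernel_mul_zonalKernel]
      ring
    rw [this]; ring
  have hF := (onsagerF_const_add_bounds hc0 hη0.le hη1 hlam0.le hφc.measurable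
    (.of_forall hb) h0).2
  simp only [hK] at hF
  rw [integral_const_mul] at hF
  refine ⟨fun p ↦ c + φ p, ⟨hφc.measurable.const_add c, fun p ↦ ?_, ?_⟩, ?_, ?_⟩
  · have := (abs_le.1 (hb p)).1
    nlinarith
  · have hcc : ∫ _ : S2, c ∂sphereMeasure = 1 := by
      have : ∫ _ : S2, c * 1 ∂sphereMeasure = c * (4 * Real.pi) := by
        rw [integral_const_mul, integral_sphere_one]
      rw [mul_one] at this
      rw [this, hc]; field_simp
    rw [integral_add (integrable_const _) hφi, h0, hcc, add_zero]
  · simp only [add_sub_cancel_left, eLpNorm_exponent_top]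
    exact (eLpNormEssSup_le_of_ae_bound (.of_forall hb)).trans_lt
      ((ENNReal.ofReal_lt_ofReal_iff hε).2 hηε)
  · have hcoef : lam * (1 / (c * (2 - η))) < Real.pi ^ 2 / 16 := by
      have : lam * (1 / (c * (2 - η))) = 4 * Real.pi * lam / (2 - η) := by rw [hc]; field_simp
      rw [this, div_lt_iff₀ (by linarith)]
      nlinarith
    have hco := mul_lt_mul_of_pos_right hcoef hN
    linarith

/-- For the Onsager free energy with the Onsager kernel, the uniform density
`ρ₀ ≡ 1/(4π)` is a local minimiser in the `L^∞` topology among probability densities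
when `λ > π/32`, and is not a local minimiser when `0 < λ < π/32`. -/
theorem uniform_local_minimiser_iff
    (lam : ℝ) :
    (Real.pi / 32 < lam → ∃ ε > (0 : ℝ), ∀ ρ : S2 → ℝ, IsProbDensity ρ →
      eLpNorm (fun p => ρ p - 1 / (4 * Real.pi)) ⊤ sphereMeasure < ENNReal.ofReal ε →
      onsagerF onsagerKernel lam (fun _ => 1 / (4 * Real.pi)) ≤ onsagerF onsagerKernel lam ρ) ∧
    (0 < lam → lam < Real.pi / 32 → ∀ ε > (0 : ℝ), ∃ ρ : S2 → ℝ, IsProbDensity ρ ∧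
      eLpNorm (fun p => ρ p - 1 / (4 * Real.pi)) ⊤ sphereMeasure < ENNReal.ofReal ε ∧
      onsagerF onsagerKernel lam ρ < onsagerF onsagerKernel lam (fun _ => 1 / (4 * Real.pi))) := by
  exact ⟨onsagerF_uniform_le, fun h0 h ε hε ↦ exists_onsagerF_lt_uniform h0 h hε⟩
end
end

section
/- Let λ' ∈ ℝ, λ' ≠ 0, and let φ ∈ L^∞(S²) satisfy the Euler–Lagrange equation λ' φ(p) = (1/Z(φ)) ∫_{S²} √(1 − (p·q)²) e^{−φ(q)} dq for almost every p ∈ S², where Z(φ) = ∫_{S²} e^{−φ(q)} dq. Then φ agrees almost everywhere with a C^∞ function on S². -/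
open MeasureTheory
open scoped Manifold

noncomputable section

section Regularity

open Metric Set Filter Topology
open scoped Pointwise

universe u

/-- A jointly continuous function on `U ×ˢ K` is bounded on a neighbourhood of each slice
when `K` is compact and `U` is open. -/
lemma exists_nhds_bound_of_continuousOn_prod {X Y W : Type*} [TopologicalSpace X]
    [LocallyCompactSpace X] [TopologicalSpace Y] [NormedAddCommGroup W]
    {U : Set X} {K : Set Y} (hU : IsOpen U) (hK : IsCompact K)
    {h : X × Y → W} (hh : ContinuousOn h (U ×ˢ K)) {x : X} (hx : x ∈ U) :
    ∃ s ∈ 𝓝 x, s ⊆ U ∧ ∃ C, ∀ y ∈ s, ∀ q ∈ K, ‖h (y, q)‖ ≤ C := by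
  obtain ⟨s, hs, hsU, hsc⟩ := local_compact_nhds (hU.mem_nhds hx)
  obtain ⟨C, hC⟩ := (hsc.prod hK).exists_bound_of_continuousOn
    (hh.mono (prod_mono hsU Subset.rfl))
  exact ⟨s, hs, hsU, C, fun y hy q hq => hC (y, q) ⟨hy, hq⟩⟩

lemma ContinuousOn.continuous_slice {X Y W : Type*} [TopologicalSpace X] [TopologicalSpace Y]
    [TopologicalSpace W] {U : Set X} {K : Set Y} {h : X × Y → W}
    (hh : ContinuousOn h (U ×ˢ K)) {x : X} (hx : x ∈ U) :
    Continuous fun q : K => h (x, q) :=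
  hh.comp_continuous (by fun_prop) fun q => ⟨hx, q.2⟩

/-- If `h` is jointly `C^n` on a neighbourhood of `U ×ˢ K` with `K` compact, then integrating
`h (x, ·)` over `K` against a bounded measurable weight gives a `C^n` function on `U`. -/
theorem contDiffOn_integral_smul {E : Type u} {E' : Type*}
    [NormedAddCommGroup E] [NormedSpace ℝ E]
    [FiniteDimensional ℝ E] [NormedAddCommGroup E'] [NormedSpace ℝ E'] [MeasurableSpace E']
    [BorelSpace E'] {K V : Set E'} (hK : IsCompact K)
    (hV : IsOpen V) (hKV : K ⊆ V) (μ : Measure K) [IsFiniteMeasure μ] {k : K → ℝ} {B : ℝ}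
    (hkm : Measurable k) (hkB : ∀ q, |k q| ≤ B) {U : Set E} (hU : IsOpen U) (n : ℕ) :
    ∀ {W : Type u} [NormedAddCommGroup W] [NormedSpace ℝ W]
      {h : E × E' → W}, ContDiffOn ℝ n h (U ×ˢ V) →
      ContDiffOn ℝ n (fun x => ∫ q, k q • h (x, q) ∂μ) U := by
  have : LocallyCompactSpace E := have := FiniteDimensional.proper_real E; inferInstance
  have : CompactSpace K := isCompact_iff_compactSpace.1 hK
  have hmeas : ∀ {W : Type u} [NormedAddCommGroup W] [NormedSpace ℝ W] {f : K → W},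
      Continuous f → AEStronglyMeasurable (fun q => k q • f q) μ := fun hf =>
    hkm.aestronglyMeasurable.smul (hf.integrable_of_hasCompactSupport (μ := μ)
      (HasCompactSupport.of_compactSpace _)).1
  have hbd : ∀ {W : Type u} [NormedAddCommGroup W] [NormedSpace ℝ W] {w : W} {C : ℝ} (q : K),
      ‖w‖ ≤ C → ‖k q • w‖ ≤ B * C := fun q hw => by
    rw [norm_smul]
    exact mul_le_mul (hkB q) hw (norm_nonneg _) ((abs_nonneg _).trans (hkB q))
  induction n with
  | zero =>
    intro W _ _ h hh
    have hc : ContinuousOn h (U ×ˢ K) := hh.continuousOn.mono (prod_mono Subset.rfl hKV)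
    refine contDiffOn_zero.2 fun x hx => ContinuousAt.continuousWithinAt ?_
    obtain ⟨s, hs, hsU, C, hC⟩ := exists_nhds_bound_of_continuousOn_prod hU hK hc hx
    refine continuousAt_of_dominated (bound := fun _ => B * C) ?_ ?_ (integrable_const _) ?_
    · filter_upwards [hs] with y hy using hmeas (hc.continuous_slice (hsU hy))
    · filter_upwards [hs] with y hy using ae_of_all _ fun q => hbd q (hC y hy q q.2)
    · refine ae_of_all _ fun q => ContinuousAt.const_smul ?_ _
      exact (hh.continuousOn.continuousAt ((hU.prod hV).mem_nhds ⟨hx, hKV q.2⟩)).comp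
        (f := fun y => (y, (q : E'))) (by fun_prop)
  | succ n ih =>
    intro W _ _ h hh
    have hc : ContinuousOn h (U ×ˢ K) := hh.continuousOn.mono (prod_mono Subset.rfl hKV)
    have hUV := hU.prod hV
    let D : E × E' → E →L[ℝ] W := fun p => (fderiv ℝ h p).comp (ContinuousLinearMap.inl ℝ E E')
    have hD : ContDiffOn ℝ n D (U ×ˢ V) :=
      ((contDiffOn_succ_iff_fderiv_of_isOpen hUV).1 (by exact_mod_cast hh)).2.2.clm_comp
        contDiffOn_const
    have hDc : ContinuousOn D (U ×ˢ K) := hD.continuousOn.mono (prod_mono Subset.rfl hKV)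
    have hderiv : ∀ x ∈ U, HasFDerivAt (fun x => ∫ q, k q • h (x, q) ∂μ)
        (∫ q, k q • D (x, q) ∂μ) x := by
      intro x hx
      obtain ⟨s, hs, hsU, C, hC⟩ := exists_nhds_bound_of_continuousOn_prod hU hK hc hx
      obtain ⟨t, ht, htU, C', hC'⟩ := exists_nhds_bound_of_continuousOn_prod hU hK hDc hx
      refine hasFDerivAt_integral_of_dominated_of_fderiv_le (bound := fun _ => B * C')
        (F' := fun x q => k q • D (x, q)) ht ?_ ?_ ?_ ?_ (integrable_const _) ?_
      · filter_upwards [hs] with y hy using hmeas (hc.continuous_slice (hsU hy))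
      · exact (integrable_const (B * C)).mono' (hmeas (hc.continuous_slice hx))
          (ae_of_all _ fun q => hbd q (hC x (mem_of_mem_nhds hs) q q.2))
      · exact hmeas (hDc.continuous_slice hx)
      · exact ae_of_all _ fun q y hy => hbd q (hC' y hy q q.2)
      · refine ae_of_all _ fun q y hy => HasFDerivAt.const_smul ?_ _
        have h1 : HasFDerivAt h (fderiv ℝ h (y, (q : E'))) (y, (q : E')) :=
          ((hh.contDiffAt (hUV.mem_nhds ⟨htU hy, hKV q.2⟩)).differentiableAt
            (by simp)).hasFDerivAt
        exact h1.comp y (hasFDerivAt_prodMk_left y (q : E'))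
    have := (contDiffOn_succ_iff_fderiv_of_isOpen (n := n) hU).2
      ⟨fun x hx => (hderiv x hx).differentiableAt.differentiableWithinAt, by simp,
        (ih hD).congr fun x hx => (hderiv x hx).fderiv⟩
    exact_mod_cast this

section ProjNorm

variable {E : Type*} [NormedAddCommGroup E] [InnerProductSpace ℝ E]

/-- The norm of the component of `x` orthogonal to the unit vector `q`. -/
def projNorm (q x : E) : ℝ := ‖x - inner ℝ q x • q‖

lemma projNorm_nonneg (q x : E) : 0 ≤ projNorm q x := norm_nonneg _

lemma projNorm_sq {q : E} (hq : ‖q‖ = 1) (x : E) :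
    projNorm q x ^ 2 = ‖x‖ ^ 2 - inner ℝ q x ^ 2 := by
  rw [projNorm, norm_sub_sq_real, norm_smul, real_inner_smul_right, real_inner_comm q x, hq,
    Real.norm_eq_abs, mul_one, sq_abs]
  ring

lemma projNorm_eq_sqrt {p q : E} (hp : ‖p‖ = 1) (hq : ‖q‖ = 1) :
    projNorm q p = √(1 - inner ℝ p q ^ 2) := by
  rw [real_inner_comm, ← one_pow 2, ← hp, ← projNorm_sq hq, Real.sqrt_sq (projNorm_nonneg q p)]

lemma projNorm_le {q : E} (hq : ‖q‖ = 1) (x : E) : projNorm q x ≤ ‖x‖ :=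
  le_of_sq_le_sq (by rw [projNorm_sq hq]; nlinarith [sq_nonneg (inner ℝ q x)]) (norm_nonneg _)

lemma lipschitzWith_projNorm {q : E} (hq : ‖q‖ = 1) : LipschitzWith 1 (projNorm q) := by
  refine LipschitzWith.of_dist_le_mul fun x y => ?_
  rw [NNReal.coe_one, one_mul, dist_eq_norm, dist_eq_norm]
  refine (abs_norm_sub_norm_le _ _).trans (le_trans (le_of_eq ?_) (projNorm_le hq (x - y)))
  rw [projNorm, inner_sub_right, sub_smul]
  congr 1
  abel

lemma continuous_uncurry_projNorm : Continuous (Function.uncurry (projNorm (E := E))) := by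
  unfold Function.uncurry projNorm
  fun_prop

lemma projNorm_smul {r : ℝ} (hr : 0 ≤ r) (q x : E) : projNorm q (r • x) = r * projNorm q x := by
  rw [projNorm, projNorm, real_inner_smul_right, mul_smul, ← smul_sub, norm_smul,
    Real.norm_of_nonneg hr]

lemma projNorm_map (R : E ≃ₗᵢ[ℝ] E) (q x : E) : projNorm (R q) (R x) = projNorm q x := by
  rw [projNorm, projNorm, R.inner_map_map, ← map_smul, ← map_sub, R.norm_map]

lemma differentiableAt_projNorm {q x : E} (h : x ∉ Submodule.span ℝ {q}) :
    DifferentiableAt ℝ (projNorm q) x := by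
  unfold projNorm
  refine DifferentiableAt.norm ℝ (differentiableAt_id.sub
    (((differentiableAt_const q).inner ℝ differentiableAt_id).smul_const q)) fun h0 => h ?_
  rw [sub_eq_zero.1 h0]
  exact Submodule.smul_mem _ _ (Submodule.mem_span_singleton_self q)

lemma norm_fderiv_projNorm_le {q : E} (hq : ‖q‖ = 1) (x : E) :
    ‖fderiv ℝ (projNorm q) x‖ ≤ 1 := by
  simpa using norm_fderiv_le_of_lipschitz ℝ (lipschitzWith_projNorm hq) (x₀ := x)

lemma fderiv_projNorm_smul {r : ℝ} (hr : 0 < r) (q x : E) :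
    fderiv ℝ (projNorm q) (r • x) = fderiv ℝ (projNorm q) x := by
  have h1 := fderiv_comp_smul (𝕜 := ℝ) (f := projNorm q) (x := x) r
  have h2 : (projNorm q <| r • · : E → ℝ) = r • projNorm q := by
    ext y
    exact projNorm_smul hr.le q y
  rw [h2, fderiv_const_smul_field] at h1
  exact (smul_right_injective _ hr.ne' h1).symm

lemma fderiv_projNorm_map (R : E ≃ₗᵢ[ℝ] E) (q x v : E) :
    fderiv ℝ (projNorm (R q)) (R x) (R v) = fderiv ℝ (projNorm q) x v := by
  have h := R.toContinuousLinearEquiv.comp_right_fderiv (f := projNorm (R q)) (x := x)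
  have h2 : projNorm (R q) ∘ R.toContinuousLinearEquiv = projNorm q := by
    ext y
    exact projNorm_map R q y
  rw [h2] at h
  rw [h]
  rfl

/-- The reflection exchanging `x` and `‖x‖ • e` when `e` is a unit vector, written as a function
of `x` and of the argument. -/
def swapReflection (e x y : E) : E :=
  y - (2 * (inner ℝ (x - ‖x‖ • e) y / ‖x - ‖x‖ • e‖ ^ 2)) • (x - ‖x‖ • e)

lemma swapReflection_eq (e x y : E) :
    swapReflection e x y = (Submodule.span ℝ {x - ‖x‖ • e})ᗮ.reflection y := by
  rw [Submodule.reflection_orthogonal_apply, Submodule.reflection_singleton_apply, swapReflection,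
    neg_sub, mul_smul, ← Nat.cast_smul_eq_nsmul ℝ]
  simp

lemma reflection_self_eq_smul {e : E} (he : ‖e‖ = 1) (x : E) :
    (Submodule.span ℝ {x - ‖x‖ • e})ᗮ.reflection x = ‖x‖ • e :=
  Submodule.reflection_sub (by simp [norm_smul, he])

lemma contDiffOn_swapReflection (e : E) {n : WithTop ℕ∞} (V : Set E) :
    ContDiffOn ℝ n (fun p : E × E => swapReflection e p.1 p.2)
      ({x | x ≠ 0 ∧ x ≠ ‖x‖ • e} ×ˢ V) := by
  have hn : ContDiffOn ℝ n (fun p : E × E => ‖p.1‖) ({x | x ≠ 0 ∧ x ≠ ‖x‖ • e} ×ˢ V) :=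
    contDiffOn_fst.norm ℝ fun p hp => hp.1.1
  have hw : ContDiffOn ℝ n (fun p : E × E => p.1 - ‖p.1‖ • e)
      ({x | x ≠ 0 ∧ x ≠ ‖x‖ • e} ×ˢ V) :=
    contDiffOn_fst.sub (hn.smul contDiffOn_const)
  refine contDiffOn_snd.sub (ContDiffOn.smul (contDiffOn_const.mul
    ((hw.inner ℝ contDiffOn_snd).div (hw.norm_sq ℝ) fun p hp => ?_)) hw)
  exact pow_ne_zero _ (norm_ne_zero_iff.2 (sub_ne_zero.2 hp.1.2))

lemma isOpen_ne_zero_ne_norm_smul (e : E) : IsOpen {x : E | x ≠ 0 ∧ x ≠ ‖x‖ • e} :=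
  isOpen_ne.inter (isOpen_ne_fun continuous_id (by fun_prop))

variable [MeasurableSpace E] [BorelSpace E] [FiniteDimensional ℝ E]

lemma measurable_fderiv_projNorm (x : E) :
    Measurable fun q : sphere (0 : E) 1 => fderiv ℝ (projNorm (q : E)) x :=
  (measurable_fderiv_with_param ℝ (continuous_uncurry_projNorm (E := E))).comp
    (measurable_subtype_coe.prodMk measurable_const)

lemma integrable_smul_fderiv_projNorm {μ : Measure (sphere (0 : E) 1)}
    {g : sphere (0 : E) 1 → ℝ} (hg : Integrable g μ) (x : E) :
    Integrable (fun q => g q • fderiv ℝ (projNorm (q : E)) x) μ := by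
  refine hg.norm.mono' (hg.1.smul (measurable_fderiv_projNorm x).aestronglyMeasurable)
    (ae_of_all _ fun q => ?_)
  rw [norm_smul]
  exact mul_le_of_le_one_right (norm_nonneg _)
    (norm_fderiv_projNorm_le (norm_eq_of_mem_sphere q) x)

/-- The map of the unit sphere induced by a linear isometry. -/
def sphereHomeomorph (R : E ≃ₗᵢ[ℝ] E) : sphere (0 : E) 1 ≃ₜ sphere (0 : E) 1 :=
  R.toHomeomorph.subtype fun x => by simp

lemma measurePreserving_sphereHomeomorph (R : E ≃ₗᵢ[ℝ] E) :
    MeasurePreserving (sphereHomeomorph R) (volume : Measure E).toSphere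
      (volume : Measure E).toSphere := by
  refine ⟨(sphereHomeomorph R).measurable, Measure.ext fun s hs => ?_⟩
  have hs' := (sphereHomeomorph R).measurable hs
  rw [Measure.map_apply (sphereHomeomorph R).measurable hs, Measure.toSphere_apply' _ hs,
    Measure.toSphere_apply' _ hs']
  congr 1
  rw [← R.measurePreserving.measure_preimage_equiv (f := R.toMeasurableEquiv)
    (Ioo (0 : ℝ) 1 • (Subtype.val '' s))]
  congr 1
  ext x
  simp only [Set.mem_smul, mem_preimage]
  constructor
  · rintro ⟨r, hr, _, ⟨q, hq, rfl⟩, rfl⟩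
    exact ⟨r, hr, _, ⟨sphereHomeomorph R q, hq, rfl⟩, (map_smul R r (q : E)).symm⟩
  · rintro ⟨r, hr, _, ⟨q, hq, rfl⟩, h⟩
    refine ⟨r, hr, _, ⟨(sphereHomeomorph R).symm q, by simpa using hq, rfl⟩, ?_⟩
    apply R.injective
    rw [map_smul]
    refine Eq.trans ?_ h
    congr 1
    exact congrArg Subtype.val ((sphereHomeomorph R).apply_symm_apply q)

lemma ae_notMem_span_singleton (hE : 2 ≤ Module.finrank ℝ E) {x : E} (hx : x ≠ 0) :
    ∀ᵐ q : sphere (0 : E) 1 ∂(volume : Measure E).toSphere,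
      x ∉ Submodule.span ℝ {(q : E)} := by
  let L := Submodule.span ℝ {x}
  have hL : (volume : Measure E) L = 0 := by
    refine Measure.addHaar_submodule _ _ fun h => ?_
    have := finrank_span_singleton (K := ℝ) hx
    rw [show Submodule.span ℝ {x} = ⊤ from h, finrank_top] at this
    omega
  have hm : MeasurableSet {q : sphere (0 : E) 1 | (q : E) ∈ L} :=
    measurable_subtype_coe L.closed_of_finiteDimensional.measurableSet
  have h0 : (volume : Measure E).toSphere {q : sphere (0 : E) 1 | (q : E) ∈ L} = 0 := by
    rw [Measure.toSphere_apply' _ hm, measure_mono_null _ hL, mul_zero]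
    rintro _ ⟨r, -, _, ⟨q, hq, rfl⟩, rfl⟩
    exact L.smul_mem r hq
  refine measure_mono_null (fun q hq => ?_) h0
  obtain ⟨a, rfl⟩ := Submodule.mem_span_singleton.1 (not_not.1 hq)
  have ha : a ≠ 0 := fun h => hx (by simp [h])
  exact Submodule.mem_span_singleton.2 ⟨a⁻¹, by rw [smul_smul, inv_mul_cancel₀ ha, one_smul]⟩

lemma hasFDerivAt_integral_projNorm (hE : 2 ≤ Module.finrank ℝ E) {g : sphere (0 : E) 1 → ℝ}
    (hg : Integrable g (volume : Measure E).toSphere) {x : E} (hx : x ≠ 0) :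
    HasFDerivAt (fun x => ∫ q, g q * projNorm (q : E) x ∂(volume : Measure E).toSphere)
      (∫ q, g q • fderiv ℝ (projNorm (q : E)) x ∂(volume : Measure E).toSphere) x := by
  have hm : ∀ y, AEStronglyMeasurable (fun q : sphere (0 : E) 1 => g q * projNorm (q : E) y)
      (volume : Measure E).toSphere := fun y =>
    hg.1.mul (Measurable.aestronglyMeasurable
      ((continuous_uncurry_projNorm (E := E)).measurable.comp
        (measurable_subtype_coe.prodMk measurable_const)))
  refine (hasFDerivAt_integral_of_dominated_loc_of_lip (bound := fun q => ‖g q‖) univ_mem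
    (Eventually.of_forall hm) ?_ (integrable_smul_fderiv_projNorm hg x).1 ?_ hg.norm ?_).2
  · refine (hg.norm.mul_const ‖x‖).mono' (hm x) (ae_of_all _ fun q => ?_)
    rw [norm_mul]
    refine mul_le_mul_of_nonneg_left ?_ (norm_nonneg _)
    rw [Real.norm_of_nonneg (projNorm_nonneg _ x)]
    exact projNorm_le (norm_eq_of_mem_sphere q) x
  · refine ae_of_all _ fun q => LipschitzWith.lipschitzOnWith (s := univ) ?_
    refine LipschitzWith.of_dist_le_mul fun y z => ?_
    have h := (lipschitzWith_projNorm (norm_eq_of_mem_sphere q)).dist_le_mul y z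
    rw [dist_eq_norm, ← mul_sub, norm_mul, ← dist_eq_norm]
    simpa using mul_le_mul_of_nonneg_left h (norm_nonneg (g q))
  · filter_upwards [ae_notMem_span_singleton hE hx] with q hq
    exact (differentiableAt_projNorm hq).hasFDerivAt.const_mul (g q)

/-- Change of variables by the reflection exchanging `x` and `‖x‖ • e`. -/
lemma integral_fderiv_projNorm_eq {e : E} (he : ‖e‖ = 1) (G : E → ℝ) {x : E} (hx : x ≠ 0) (v : E) :
    ∫ q : sphere (0 : E) 1, G q * fderiv ℝ (projNorm (q : E)) x v ∂(volume : Measure E).toSphere =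
      ∫ q : sphere (0 : E) 1, G (swapReflection e x q) *
        fderiv ℝ (projNorm (q : E)) e (swapReflection e x v) ∂(volume : Measure E).toSphere := by
  let R := (Submodule.span ℝ {x - ‖x‖ • e})ᗮ.reflection
  rw [← (measurePreserving_sphereHomeomorph R).integral_comp
    (sphereHomeomorph R).measurableEmbedding]
  refine integral_congr_ae (ae_of_all _ fun q => ?_)
  have h1 : ((sphereHomeomorph R q : sphere (0 : E) 1) : E) = R q := rfl
  have h2 : R (‖x‖ • e) = x := by
    rw [← reflection_self_eq_smul he x]
    exact Submodule.reflection_reflection _ x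
  have h3 : R (R v) = v := Submodule.reflection_reflection _ v
  have h4 := fderiv_projNorm_map R (q : E) (‖x‖ • e) (R v)
  rw [h2, h3, fderiv_projNorm_smul (norm_pos_iff.2 hx)] at h4
  simp only [h1, h4, swapReflection_eq, R]

/-- One step of the bootstrap: a solution `Ψ` of
`Ψ x = c ∫ exp (-Ψ q) * projNorm q x` of class `C^n` away from the origin
is of class `C^(n+1)` there. -/
lemma contDiffOn_succ_of_eq_integral {E : Type} [NormedAddCommGroup E] [InnerProductSpace ℝ E]
    [MeasurableSpace E] [BorelSpace E] [FiniteDimensional ℝ E] (hE : 2 ≤ Module.finrank ℝ E) {Ψ : E → ℝ} {c : ℝ}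
    (h : ∀ x, Ψ x = c * ∫ q : sphere (0 : E) 1, Real.exp (-Ψ q) * projNorm (q : E) x
      ∂(volume : Measure E).toSphere) {n : ℕ} (hn : ContDiffOn ℝ n Ψ {0}ᶜ) :
    ContDiffOn ℝ (n + 1 : ℕ) Ψ {0}ᶜ := by
  have hsph : ∀ q : sphere (0 : E) 1, (q : E) ≠ 0 := fun q => ne_zero_of_mem_unit_sphere q
  have hcs : ∀ {f : sphere (0 : E) 1 → ℝ}, Continuous f →
      Integrable f (volume : Measure E).toSphere := fun hf =>
    hf.integrable_of_hasCompactSupport (HasCompactSupport.of_compactSpace _)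
  have hG : ContDiffOn ℝ n (fun x => Real.exp (-Ψ x)) {0}ᶜ := hn.neg.exp
  have hint : Integrable (fun q : sphere (0 : E) 1 => Real.exp (-Ψ q))
      (volume : Measure E).toSphere :=
    hcs (hG.continuousOn.comp_continuous continuous_subtype_val hsph)
  have hderiv : ∀ x ≠ 0, HasFDerivAt Ψ (c • ∫ q : sphere (0 : E) 1,
      Real.exp (-Ψ q) • fderiv ℝ (projNorm (q : E)) x ∂(volume : Measure E).toSphere) x := by
    intro x hx
    exact ((hasFDerivAt_integral_projNorm hE hint hx).const_mul c).congr_of_eventuallyEq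
      (Eventually.of_forall h)
  have hopen : IsOpen ({0}ᶜ : Set E) := isOpen_compl_singleton
  suffices hd : ContDiffOn ℝ n (fderiv ℝ Ψ) {0}ᶜ by
    have := (contDiffOn_succ_iff_fderiv_of_isOpen (n := n) hopen).2
      ⟨fun x hx => (hderiv x hx).differentiableAt.differentiableWithinAt, by simp, hd⟩
    exact_mod_cast this
  intro x₁ hx₁
  have hnorm : ‖x₁‖ ≠ 0 := norm_ne_zero_iff.2 hx₁
  let e : E := -(‖x₁‖⁻¹ • x₁)
  have he : ‖e‖ = 1 := by simp [e, norm_smul, hnorm]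
  let U : Set E := {x | x ≠ 0 ∧ x ≠ ‖x‖ • e}
  have hU : IsOpen U := isOpen_ne_zero_ne_norm_smul e
  have hxU : x₁ ∈ U := by
    refine ⟨hx₁, fun h0 => hx₁ ?_⟩
    rw [smul_neg, smul_smul, mul_inv_cancel₀ hnorm, one_smul] at h0
    have h2 := eq_neg_iff_add_eq_zero.1 h0
    rw [← two_smul ℝ] at h2
    exact (smul_eq_zero.1 h2).resolve_left two_ne_zero
  refine ContDiffAt.contDiffWithinAt (ContDiffOn.contDiffAt ?_ (hU.mem_nhds hxU))
  have hR0 : ∀ x y : E, y ≠ 0 → swapReflection e x y ≠ 0 := fun x y hy => by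
    rw [swapReflection_eq]
    simpa using hy
  have hGR : ContDiffOn ℝ n (fun p : E × E => Real.exp (-Ψ (swapReflection e p.1 p.2)))
      (U ×ˢ {0}ᶜ) :=
    hG.comp (contDiffOn_swapReflection e _) fun p hp => hR0 p.1 p.2 hp.2
  have hGRint : ∀ x ∈ U, Integrable (fun q : sphere (0 : E) 1 =>
      Real.exp (-Ψ (swapReflection e x q))) (volume : Measure E).toSphere := fun x hx =>
    hcs (hGR.continuousOn.comp_continuous (f := fun q : sphere (0 : E) 1 => (x, (q : E)))
      (by fun_prop) fun q => ⟨hx, hsph q⟩)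
  let L : E → E →L[ℝ] ℝ := fun x => ∫ q : sphere (0 : E) 1,
    Real.exp (-Ψ (swapReflection e x q)) • fderiv ℝ (projNorm (q : E)) e
      ∂(volume : Measure E).toSphere
  have hLapp : ∀ x ∈ U, ∀ u, L x u = ∫ q : sphere (0 : E) 1,
      Real.exp (-Ψ (swapReflection e x q)) * fderiv ℝ (projNorm (q : E)) e u
      ∂(volume : Measure E).toSphere := fun x hx u =>
    ContinuousLinearMap.integral_apply (integrable_smul_fderiv_projNorm (hGRint x hx) e) u
  have hL : ContDiffOn ℝ n L U := by
    refine contDiffOn_clm_apply.2 fun u => ?_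
    have hk := contDiffOn_integral_smul (isCompact_sphere (0 : E) 1) hopen
      (fun q hq => hsph ⟨q, hq⟩) (volume : Measure E).toSphere
      (k := fun q => fderiv ℝ (projNorm (q : E)) e u) (B := ‖u‖)
      ((ContinuousLinearMap.measurable_apply u).comp (measurable_fderiv_projNorm e))
      (fun q => ?_) hU n hGR
    · refine hk.congr fun x hx => ?_
      rw [hLapp x hx]
      simp only [smul_eq_mul, mul_comm]
    · exact (ContinuousLinearMap.le_opNorm _ u).trans (mul_le_of_le_one_left (norm_nonneg _)
        (norm_fderiv_projNorm_le (norm_eq_of_mem_sphere q) e))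
  refine contDiffOn_clm_apply.2 fun v => ?_
  have hRv : ContDiffOn ℝ n (fun x => swapReflection e x v) U :=
    (contDiffOn_swapReflection e univ).comp (f := fun x => (x, v))
      (contDiffOn_id.prodMk contDiffOn_const) fun x hx => ⟨hx, mem_univ _⟩
  refine (contDiffOn_const (c := c)).mul (hL.clm_apply hRv) |>.congr fun x hx => ?_
  rw [(hderiv x hx.1).fderiv, _root_.smul_apply, smul_eq_mul, hLapp x hx,
    ContinuousLinearMap.integral_apply (integrable_smul_fderiv_projNorm hint x)]
  congr 1
  exact integral_fderiv_projNorm_eq he (fun y => Real.exp (-Ψ y)) hx.1 v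

end ProjNorm

/-- Solutions of `Ψ x = c ∫ exp (-Ψ q) * projNorm q x` are smooth away from the origin. -/
lemma contDiffOn_infty_of_eq_integral {E : Type} [NormedAddCommGroup E] [InnerProductSpace ℝ E]
    [MeasurableSpace E] [BorelSpace E] [FiniteDimensional ℝ E] (hE : 2 ≤ Module.finrank ℝ E)
    {Ψ : E → ℝ} {c : ℝ}
    (hint : Integrable (fun q : sphere (0 : E) 1 => Real.exp (-Ψ q))
      (volume : Measure E).toSphere)
    (h : ∀ x, Ψ x = c * ∫ q : sphere (0 : E) 1, Real.exp (-Ψ q) * projNorm (q : E) x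
      ∂(volume : Measure E).toSphere) :
    ContDiffOn ℝ (⊤ : ℕ∞) Ψ {0}ᶜ := by
  refine contDiffOn_infty.2 fun n => ?_
  induction n with
  | zero =>
    refine contDiffOn_zero.2 fun x hx => ContinuousAt.continuousWithinAt ?_
    rw [funext h]
    exact ((hasFDerivAt_integral_projNorm hE hint hx).const_mul c).continuousAt
  | succ n ih => exact contDiffOn_succ_of_eq_integral hE h ih

end Regularity

/-- Any `φ ∈ L^∞(S²)` satisfying the Euler–Lagrange equation
`λ' φ(p) = (1/Z(φ)) ∫ √(1 − (p·q)²) e^(−φ(q)) dq` (a.e., with `λ' ≠ 0` and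
`Z(φ) = ∫ e^(−φ)`) agrees almost everywhere with a `C^∞` function on `S²`. -/
theorem regularity_of_EL_solution (lam : ℝ) (hlam : lam ≠ 0)
    (φ : S2 → ℝ) (hmeas : Measurable φ) (hbdd : ∃ C : ℝ, ∀ᵐ p ∂sphereMeasure, |φ p| ≤ C)
    (hEL : ∀ᵐ p ∂sphereMeasure, lam * φ p =
      (1 / ∫ q, Real.exp (-φ q) ∂sphereMeasure) *
        ∫ q, Real.sqrt (1 - (inner (𝕜 := ℝ) (p : EuclideanSpace ℝ (Fin 3))
          (q : EuclideanSpace ℝ (Fin 3))) ^ 2) * Real.exp (-φ q) ∂sphereMeasure) :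
    haveI : Fact (Module.finrank ℝ (EuclideanSpace ℝ (Fin 3)) = 2 + 1) :=
      ⟨finrank_euclideanSpace_fin⟩
    ∃ ψ : S2 → ℝ, ContMDiff (𝓡 2) 𝓘(ℝ, ℝ) (⊤ : ℕ∞) ψ ∧ φ =ᵐ[sphereMeasure] ψ := by
  have hE : 2 ≤ Module.finrank ℝ (EuclideanSpace ℝ (Fin 3)) := by simp
  let c : ℝ := lam⁻¹ * (1 / ∫ q, Real.exp (-φ q) ∂sphereMeasure)
  let Ψ : EuclideanSpace ℝ (Fin 3) → ℝ := fun x =>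
    c * ∫ q : S2, Real.exp (-φ q) * projNorm (q : EuclideanSpace ℝ (Fin 3)) x ∂sphereMeasure
  have hφ : φ =ᵐ[sphereMeasure] fun p : S2 => Ψ p := by
    filter_upwards [hEL] with p hp
    rw [← inv_mul_cancel_left₀ hlam (φ p), hp, ← mul_assoc]
    refine congrArg (c * ·) (integral_congr_ae (ae_of_all _ fun q => ?_))
    simp only
    rw [projNorm_eq_sqrt (norm_eq_of_mem_sphere p) (norm_eq_of_mem_sphere q), mul_comm]
  have hexp : (fun q : S2 => Real.exp (-φ q)) =ᵐ[sphereMeasure] fun q => Real.exp (-Ψ q) := by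
    filter_upwards [hφ] with q hq
    rw [hq]
  have : IsFiniteMeasure sphereMeasure := by
    unfold sphereMeasure
    infer_instance
  have hint : Integrable (fun q : S2 => Real.exp (-φ q)) sphereMeasure := by
    obtain ⟨C, hC⟩ := hbdd
    refine (integrable_const (Real.exp C)).mono' hmeas.neg.exp.aestronglyMeasurable ?_
    filter_upwards [hC] with q hq
    rw [Real.norm_of_nonneg (Real.exp_nonneg _)]
    exact Real.exp_le_exp.2 ((neg_le_abs _).trans hq)
  have hΨ : ContDiffOn ℝ (⊤ : ℕ∞) Ψ {0}ᶜ :=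
    contDiffOn_infty_of_eq_integral (c := c) hE (hint.congr hexp) fun x =>
      congrArg (c * ·) (integral_congr_ae (hexp.mul (ae_eq_refl _)))
  have : Fact (Module.finrank ℝ (EuclideanSpace ℝ (Fin 3)) = 2 + 1) :=
    ⟨finrank_euclideanSpace_fin⟩
  refine ⟨fun p => Ψ p, fun p => ?_, hφ⟩
  have hp : ContDiffAt ℝ (⊤ : ℕ∞) Ψ p :=
    hΨ.contDiffAt (isOpen_compl_singleton.mem_nhds (ne_zero_of_mem_unit_sphere p))
  exact hp.contMDiffAt.comp p contMDiff_coe_sphere.contMDiffAt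
end
end

section
/- For s = 2 one has Γ(s/2+1/2) Γ(s/2−1/2)/(8 Γ(s/2+1) Γ(s/2+2)) = π/32, and for every even integer s ≥ 4, Γ(s/2+1/2) Γ(s/2−1/2)/(8 Γ(s/2+1) Γ(s/2+2)) < π/32. Hence λ₂ = π/32 is the largest positive bifurcation value of the Onsager model. -/
/-- The Onsager bifurcation value `λ_O(s)` written in terms of `x = s / 2`. -/
noncomputable def onsagerValue (x : ℝ) : ℝ :=
  Real.Gamma (x + 1 / 2) * Real.Gamma (x - 1 / 2) /
    (8 * Real.Gamma (x + 1) * Real.Gamma (x + 2))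

theorem onsagerValue_one : onsagerValue 1 = Real.pi / 32 := by
  have h₁ : Real.Gamma ((1 : ℝ) + 1 / 2) = 1 / 2 * √Real.pi := by
    rw [add_comm, Real.Gamma_add_one (by norm_num), Real.Gamma_one_half_eq]
  have h₂ : Real.Gamma ((1 : ℝ) - 1 / 2) = √Real.pi := by
    rw [← Real.Gamma_one_half_eq]
    norm_num
  have h₃ : Real.Gamma ((1 : ℝ) + 1) = 1 := by
    rw [Real.Gamma_add_one one_ne_zero, Real.Gamma_one, one_mul]
  have h₄ : Real.Gamma ((1 : ℝ) + 2) = 2 := by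
    rw [show (1 : ℝ) + 2 = (1 + 1) + 1 by norm_num, Real.Gamma_add_one (by norm_num), h₃]
    norm_num
  rw [onsagerValue, h₁, h₂, h₃, h₄, mul_assoc (1 / 2), Real.mul_self_sqrt Real.pi_pos.le]
  ring

theorem onsagerValue_pos {x : ℝ} (hx : 1 / 2 < x) : 0 < onsagerValue x := by
  have h₁ := Real.Gamma_pos_of_pos (show 0 < x + 1 / 2 by linarith)
  have h₂ := Real.Gamma_pos_of_pos (show 0 < x - 1 / 2 by linarith)
  have h₃ := Real.Gamma_pos_of_pos (show 0 < x + 1 by linarith)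
  have h₄ := Real.Gamma_pos_of_pos (show 0 < x + 2 by linarith)
  unfold onsagerValue
  positivity

theorem onsagerValue_add_one {x : ℝ} (hx : 1 / 2 < x) :
    onsagerValue (x + 1) =
      onsagerValue x * ((x + 1 / 2) * (x - 1 / 2) / ((x + 1) * (x + 2))) := by
  have h₁ : Real.Gamma (x + 1 + 1 / 2) = (x + 1 / 2) * Real.Gamma (x + 1 / 2) := by
    rw [← Real.Gamma_add_one (by linarith), add_right_comm]
  have h₂ : Real.Gamma (x + 1 - 1 / 2) = (x - 1 / 2) * Real.Gamma (x - 1 / 2) := by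
    rw [← Real.Gamma_add_one (by linarith), add_sub_right_comm]
  have h₃ : Real.Gamma (x + 1 + 1) = (x + 1) * Real.Gamma (x + 1) :=
    Real.Gamma_add_one (by linarith)
  have h₄ : Real.Gamma (x + 1 + 2) = (x + 2) * Real.Gamma (x + 2) := by
    rw [← Real.Gamma_add_one (by linarith), add_right_comm]
  rw [onsagerValue, onsagerValue, h₁, h₂, h₃, h₄, div_mul_div_comm]
  congr 1 <;> ring

theorem onsagerValue_add_one_lt {x : ℝ} (hx : 1 / 2 < x) :
    onsagerValue (x + 1) < onsagerValue x := by
  rw [onsagerValue_add_one hx]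
  refine mul_lt_of_lt_one_right (onsagerValue_pos hx) ?_
  rw [div_lt_one (mul_pos (by linarith) (by linarith))]
  nlinarith

theorem onsagerValue_natCast_lt {n : ℕ} (hn : 2 ≤ n) : onsagerValue n < Real.pi / 32 := by
  rw [← onsagerValue_one]
  induction n, hn using Nat.le_induction with
  | base =>
    have h := onsagerValue_add_one_lt (x := 1) (by norm_num)
    rwa [one_add_one_eq_two] at h
  | succ n hn ih =>
    have hn' : (2 : ℝ) ≤ n := by exact_mod_cast hn
    rw [Nat.cast_succ]
    exact (onsagerValue_add_one_lt (by linarith)).trans ih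

/-- For `s = 2` the bifurcation value `Γ(s/2+1/2)Γ(s/2-1/2)/(8Γ(s/2+1)Γ(s/2+2))` equals
`π/32`, and for every even integer `s ≥ 4` it is strictly smaller than `π/32`; hence
`λ₂ = π/32` is the largest positive bifurcation value of the Onsager model. -/
theorem largest_bifurcation_value :
    Real.Gamma ((2 : ℝ) / 2 + 1 / 2) * Real.Gamma ((2 : ℝ) / 2 - 1 / 2) /
        (8 * Real.Gamma ((2 : ℝ) / 2 + 1) * Real.Gamma ((2 : ℝ) / 2 + 2)) = Real.pi / 32 ∧
    ∀ s : ℕ, Even s → 4 ≤ s →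
      Real.Gamma ((s : ℝ) / 2 + 1 / 2) * Real.Gamma ((s : ℝ) / 2 - 1 / 2) /
          (8 * Real.Gamma ((s : ℝ) / 2 + 1) * Real.Gamma ((s : ℝ) / 2 + 2)) <
        Real.pi / 32 := by
  refine ⟨?_, fun s hs hs4 => ?_⟩
  · rw [div_self (two_ne_zero' ℝ)]
    exact onsagerValue_one
  · obtain ⟨n, rfl⟩ := hs
    have h : ((n + n : ℕ) : ℝ) / 2 = n := by
      push_cast
      ring
    rw [h]
    exact onsagerValue_natCast_lt (by omega)
end
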